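/- arXiv:1908.09143 — 6 statements merged into one kernel-verified Lean document; each statement's English description precedes it below -/
import Mathlib

section
/- Let α ∈ (1,2) and set c_α = α·2^(α−1)·Γ((1+α)/2)/(√π·Γ(1−α/2)). Let u : ℝ → ℝ be twice continuously differentiable with u, u′ and u″ bounded, and let x ∈ ℝ be such that the function y ↦ u″(y)·|x−y|^(1−α) is Lebesgue integrable on ℝ. Then the principal-value limit lim_{ε→0⁺} ∫_{|y|>ε} (u(x)−u(x+y))/|y|^(1+α) dy exists, and c_α · lim_{ε→0⁺} ∫_{|y|>ε} (u(x)−u(x+y))/|y|^(1+α) dy = (c_α/(α(1−α))) · ∫_ℝ u″(y)·|x−y|^(1−α) dy. -/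
open MeasureTheory Filter Set Real

/-- A function with a derivative bounded by `C` on `[0, y]` and vanishing at `0` is at most
`C * y` at `y`. -/
lemma abs_le_mul_of_hasDerivAt_of_abs_deriv_le {f f' : ℝ → ℝ} (hf : ∀ y, HasDerivAt f (f' y) y)
    (hf0 : f 0 = 0) {C y : ℝ} (hy : 0 ≤ y) (hC : ∀ t ∈ Icc 0 y, |f' t| ≤ C) :
    |f y| ≤ C * y := by
  have h := (convex_Icc 0 y).norm_image_sub_le_of_norm_hasDerivWithin_le
    (fun t _ => (hf t).hasDerivWithinAt) hC (left_mem_Icc.2 hy) (right_mem_Icc.2 hy)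
  simpa [hf0, abs_of_nonneg hy] using h

/-- A bounded continuous function times an integrable power is integrable on `(ε, ∞)`. -/
lemma integrableOn_Ioi_mul_rpow_of_bounded {v : ℝ → ℝ} (hv : Continuous v) {B : ℝ}
    (hB : ∀ y, |v y| ≤ B) {s ε : ℝ} (hs : s < -1) (hε : 0 < ε) :
    IntegrableOn (fun y => v y * y ^ s) (Ioi ε) :=
  (integrableOn_Ioi_rpow_of_lt hs hε).bdd_mul (c := B) hv.aestronglyMeasurable
    (Eventually.of_forall hB)

lemma tendsto_bounded_mul_rpow_atTop {v : ℝ → ℝ} {B : ℝ} (hB : ∀ y, |v y| ≤ B) {s : ℝ}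
    (hs : s < 0) : Tendsto (fun y => v y * y ^ s) atTop (nhds 0) := by
  have h : Tendsto (fun y : ℝ => y ^ s) atTop (nhds 0) := by
    simpa using tendsto_rpow_neg_atTop (neg_pos.2 hs)
  exact bdd_le_mul_tendsto_zero' B (Eventually.of_forall hB) h

lemma tendsto_mul_rpow_nhdsGT_zero {v : ℝ → ℝ} {B p s : ℝ}
    (hB : ∀ y, 0 < y → |v y| ≤ B * y ^ p) (hps : 0 < p + s) :
    Tendsto (fun y => v y * y ^ s) (nhdsWithin 0 (Ioi 0)) (nhds 0) := by
  have h : Tendsto (fun y : ℝ => B * y ^ (p + s)) (nhdsWithin 0 (Ioi 0)) (nhds 0) := by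
    have := ((continuous_rpow_const hps.le).tendsto 0).const_mul B
    rw [zero_rpow hps.ne', mul_zero] at this
    exact this.mono_left nhdsWithin_le_nhds
  refine squeeze_zero_norm' ?_ h
  filter_upwards [self_mem_nhdsWithin] with y hy
  have hy : 0 < y := hy
  rw [norm_mul, norm_of_nonneg (rpow_nonneg hy.le s), rpow_add hy, ← mul_assoc]
  exact mul_le_mul_of_nonneg_right (hB y hy) (rpow_nonneg hy.le s)

/-- Two integrations by parts on `(ε, ∞)` followed by `ε → 0`. -/
lemma tendsto_integral_Ioi_mul_rpow {α : ℝ} (hα : α ∈ Ioo (1 : ℝ) 2) {v v' v'' : ℝ → ℝ}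
    (hv : ∀ y, HasDerivAt v (v' y) y) (hv' : ∀ y, HasDerivAt v' (v'' y) y)
    (h0 : v 0 = 0) (h0' : v' 0 = 0) {B B' B'' : ℝ} (hB : ∀ y, |v y| ≤ B)
    (hB' : ∀ y, |v' y| ≤ B') (hB'' : ∀ y, |v'' y| ≤ B'')
    (hint : IntegrableOn (fun y => v'' y * y ^ (1 - α)) (Ioi 0)) :
    Tendsto (fun ε => ∫ y in Ioi ε, v y * y ^ (-1 - α)) (nhdsWithin 0 (Ioi 0))
      (nhds ((∫ y in Ioi 0, v'' y * y ^ (1 - α)) / (α * (α - 1)))) := by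
  obtain ⟨h1, h2⟩ := hα
  have hα0 : α ≠ 0 := by linarith
  have hα1 : α - 1 ≠ 0 := by linarith
  set F : ℝ → ℝ := fun y => -(v y * y ^ (-α)) / α - v' y * y ^ (1 - α) / (α * (α - 1))
  have hderiv : ∀ y, 0 < y → HasDerivAt F
      (v y * y ^ (-1 - α) - v'' y * y ^ (1 - α) / (α * (α - 1))) y := by
    intro y hy
    have e1 := (hv y).mul (hasDerivAt_rpow_const (p := -α) (Or.inl hy.ne'))
    have e2 := (hv' y).mul (hasDerivAt_rpow_const (p := 1 - α) (Or.inl hy.ne'))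
    refine ((e1.neg.div_const α).sub (e2.div_const (α * (α - 1)))).congr_deriv ?_
    rw [show -α - 1 = -1 - α by ring, show 1 - α - 1 = -α by ring]
    field_simp
    ring
  have htop : Tendsto F atTop (nhds 0) := by
    simpa using ((tendsto_bounded_mul_rpow_atTop hB (s := -α) (by linarith)).neg.div_const α).sub
      ((tendsto_bounded_mul_rpow_atTop hB' (s := 1 - α) (by linarith)).div_const (α * (α - 1)))
  have hv'le : ∀ y, 0 ≤ y → |v' y| ≤ B'' * y := fun y hy =>
    abs_le_mul_of_hasDerivAt_of_abs_deriv_le hv' h0' hy fun t _ => hB'' t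
  have hB''0 : 0 ≤ B'' := (abs_nonneg _).trans (hB'' 0)
  have hvle : ∀ y, 0 ≤ y → |v y| ≤ B'' * y * y := fun y hy =>
    abs_le_mul_of_hasDerivAt_of_abs_deriv_le hv h0 hy fun t ht =>
      (hv'le t ht.1).trans (mul_le_mul_of_nonneg_left ht.2 hB''0)
  have hzero : Tendsto F (nhdsWithin 0 (Ioi 0)) (nhds 0) := by
    have t1 : Tendsto (fun y => v y * y ^ (-α)) (nhdsWithin 0 (Ioi 0)) (nhds 0) :=
      tendsto_mul_rpow_nhdsGT_zero (B := B'') (p := 2)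
        (fun y hy => by simpa [mul_assoc, ← sq] using hvle y hy.le) (by linarith)
    have t2 : Tendsto (fun y => v' y * y ^ (1 - α)) (nhdsWithin 0 (Ioi 0)) (nhds 0) :=
      tendsto_mul_rpow_nhdsGT_zero (B := B'') (p := 1)
        (fun y hy => by simpa using hv'le y hy.le) (by linarith)
    simpa using (t1.neg.div_const α).sub (t2.div_const (α * (α - 1)))
  have hvc : Continuous v := continuous_iff_continuousAt.2 fun y => (hv y).continuousAt
  have key : ∀ ε, 0 < ε → ∫ y in Ioi ε, v y * y ^ (-1 - α) =
      (∫ y in Ioi ε, v'' y * y ^ (1 - α)) / (α * (α - 1)) - F ε := by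
    intro ε hε
    have i1 := integrableOn_Ioi_mul_rpow_of_bounded hvc hB (s := -1 - α) (by linarith) hε
    have i2 : IntegrableOn (fun y => v'' y * y ^ (1 - α) / (α * (α - 1))) (Ioi ε) :=
      (hint.mono_set (Ioi_subset_Ioi hε.le)).div_const _
    have h := integral_Ioi_of_hasDerivAt_of_tendsto'
      (fun y (hy : y ∈ Ici ε) => hderiv y (hε.trans_le hy)) (i1.sub i2) htop
    rw [integral_sub i1 i2, integral_div] at h
    linarith
  have hlim : Tendsto (fun ε => ∫ y in Ioi ε, v'' y * y ^ (1 - α)) (nhdsWithin 0 (Ioi 0))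
      (nhds (∫ y in Ioi 0, v'' y * y ^ (1 - α))) := by
    have hc : AECover (volume.restrict (Ioi (0 : ℝ))) (nhdsWithin 0 (Ioi 0)) fun ε : ℝ => Ioi ε :=
      aecover_Ioi_of_Ioi (tendsto_id.mono_left nhdsWithin_le_nhds)
    refine (hc.integral_tendsto_of_countably_generated hint).congr' ?_
    filter_upwards [self_mem_nhdsWithin] with ε hε
    rw [Measure.restrict_restrict measurableSet_Ioi,
      inter_eq_left.2 (Ioi_subset_Ioi (le_of_lt hε))]
  have hfin := (hlim.div_const (α * (α - 1))).sub hzero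
  rw [sub_zero] at hfin
  refine hfin.congr' ?_
  filter_upwards [self_mem_nhdsWithin] with ε hε
  exact (key ε hε).symm

/-- Folding an integral over `ε < |y|` onto the half-line `(ε, ∞)`. -/
lemma setIntegral_lt_abs_eq_integral_Ioi {g : ℝ → ℝ} {ε : ℝ} (hε : 0 ≤ ε)
    (h1 : IntegrableOn g (Ioi ε)) (h2 : IntegrableOn (fun y => g (-y)) (Ioi ε)) :
    ∫ y in {y : ℝ | ε < |y|}, g y = ∫ y in Ioi ε, (g y + g (-y)) := by
  have hset : {y : ℝ | ε < |y|} = Ioi ε ∪ Iio (-ε) := by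
    ext y
    simp only [mem_ofPred_eq, lt_abs, mem_union, mem_Ioi, mem_Iio, lt_neg]
  have hdisj : Disjoint (Ioi ε) (Iio (-ε)) :=
    Set.disjoint_left.2 fun y (hy : ε < y) (hy' : y < -ε) => by linarith
  have h3 : IntegrableOn g (Iio (-ε)) := by
    rw [← neg_neg ε] at h2
    simpa using h2.comp_neg_Iio
  rw [hset, setIntegral_union hdisj measurableSet_Iio h1 h3, integral_add h1 h2,
    integral_comp_neg_Ioi, integral_Iic_eq_integral_Iio]

/-- Case α ∈ (1,2) of Lemma 1: the principal-value form of the fractional Laplacian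
equals the second-derivative representation. -/
theorem stmt_0 (α : ℝ) (hα : α ∈ Set.Ioo (1:ℝ) 2)
    (u : ℝ → ℝ) (hu : ContDiff ℝ 2 u)
    (hub : ∃ M, ∀ y, |u y| ≤ M)
    (hub' : ∃ M, ∀ y, |deriv u y| ≤ M)
    (hub'' : ∃ M, ∀ y, |deriv (deriv u) y| ≤ M)
    (x : ℝ)
    (hint : Integrable (fun y => deriv (deriv u) y * |x - y| ^ (1 - α))) :
    ∃ I : ℝ,
      Tendsto (fun ε : ℝ => ∫ y in {y : ℝ | ε < |y|}, (u x - u (x + y)) / |y| ^ (1 + α))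
        (nhdsWithin 0 (Set.Ioi 0)) (nhds I) ∧
      (α * 2 ^ (α - 1) * Real.Gamma ((1 + α) / 2) / (Real.sqrt π * Real.Gamma (1 - α / 2))) * I
        = (α * 2 ^ (α - 1) * Real.Gamma ((1 + α) / 2) / (Real.sqrt π * Real.Gamma (1 - α / 2)))
            / (α * (1 - α)) * ∫ y : ℝ, deriv (deriv u) y * |x - y| ^ (1 - α) := by
  obtain ⟨M, hM⟩ := hub
  obtain ⟨M', hM'⟩ := hub'
  obtain ⟨M'', hM''⟩ := hub''
  have hα1 := hα.1
  have hd : ∀ y, HasDerivAt u (deriv u y) y := fun y =>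
    (hu.differentiable (by norm_num) y).hasDerivAt
  have hd' : ∀ y, HasDerivAt (deriv u) (deriv (deriv u) y) y := fun y =>
    (((contDiff_succ_iff_deriv (n := 1)).1 hu).2.2.differentiable (by norm_num) y).hasDerivAt
  -- the second-derivative integrand, centred at `x`
  set h : ℝ → ℝ := fun y => deriv (deriv u) (x + y) * |y| ^ (1 - α) with hh
  have hshift : (fun y => deriv (deriv u) (x + y) * |x - (x + y)| ^ (1 - α)) = h := by
    funext y
    simp [hh]
  have hhint : Integrable h := hshift ▸ hint.comp_add_left x
  have hheq : ∫ y : ℝ, deriv (deriv u) y * |x - y| ^ (1 - α) = ∫ y, h y := by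
    rw [← hshift]
    exact (integral_add_left_eq_self (fun y => deriv (deriv u) y * |x - y| ^ (1 - α)) x).symm
  have hfold : ∫ y, h y = ∫ y in Ioi 0, (h y + h (-y)) := by
    rw [← setIntegral_lt_abs_eq_integral_Ioi le_rfl hhint.integrableOn hhint.comp_neg.integrableOn,
      ← setIntegral_univ (f := h) (μ := volume)]
    refine (setIntegral_congr_set ?_).symm
    have : {y : ℝ | 0 < |y|} = {0}ᶜ := by
      ext y
      simp
    rw [this]
    exact eventuallyEq_univ.2 (compl_mem_ae_iff.2 (measure_singleton 0))
  have hlim := tendsto_integral_Ioi_mul_rpow hα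
    (v := fun y => (u x - u (x + y)) + (u x - u (x - y)))
    (v' := fun y => -deriv u (x + y) + deriv u (x - y))
    (v'' := fun y => -deriv (deriv u) (x + y) - deriv (deriv u) (x - y))
    (B := (M + M) + (M + M)) (B' := M' + M') (B'' := M'' + M'')
    (fun y => by
      have a := (hd (x + y)).comp_const_add x y
      have b := (hd (x - y)).comp_const_sub x y
      exact ((a.const_sub (u x)).add (b.const_sub (u x))).congr_deriv (by ring))
    (fun y => by
      have a := (hd' (x + y)).comp_const_add x y
      have b := (hd' (x - y)).comp_const_sub x y
      exact (a.neg.add b).congr_deriv (by ring))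
    (by simp) (by simp)
    (fun y => (abs_add_le _ _).trans (add_le_add
      ((abs_sub _ _).trans (add_le_add (hM _) (hM _)))
      ((abs_sub _ _).trans (add_le_add (hM _) (hM _)))))
    (fun y => (abs_add_le _ _).trans (add_le_add ((abs_neg _).trans_le (hM' _)) (hM' _)))
    (fun y => (abs_sub _ _).trans (add_le_add ((abs_neg _).trans_le (hM'' _)) (hM'' _)))
    (by
      refine IntegrableOn.congr_fun (hhint.add hhint.comp_neg).neg.integrableOn ?_ measurableSet_Ioi
      intro y hy
      have hy : 0 < y := hy
      simp only [hh, Pi.neg_apply, Pi.add_apply, abs_neg, abs_of_pos hy, ← sub_eq_add_neg]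
      ring)
  refine ⟨_, hlim.congr' ?_, ?_⟩
  · filter_upwards [self_mem_nhdsWithin] with ε hε
    have hε : 0 < ε := hε
    have hpow : ∀ y ∈ Ioi ε, ∀ c : ℝ, c * y ^ (-1 - α) = c / |y| ^ (1 + α) := by
      intro y hy c
      have hy : 0 < y := hε.trans hy
      rw [abs_of_pos hy, show -1 - α = -(1 + α) by ring, rpow_neg hy.le, div_eq_mul_inv]
    have hint' : ∀ w : ℝ → ℝ, Continuous w → (∀ y, |w y| ≤ M) →
        IntegrableOn (fun y => (u x - w y) / |y| ^ (1 + α)) (Ioi ε) := fun w hw hwM =>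
      (integrableOn_Ioi_mul_rpow_of_bounded (v := fun y => u x - w y) (B := M + M)
        (s := -1 - α) (by fun_prop)
        (fun y => (abs_sub _ _).trans (add_le_add (hM _) (hwM _))) (by linarith) hε).congr_fun
        (fun y hy => hpow y hy _) measurableSet_Ioi
    have hc := hu.continuous
    rw [setIntegral_lt_abs_eq_integral_Ioi hε.le
      (hint' (fun y => u (x + y)) (by fun_prop) fun y => hM _)
      (by simpa using hint' (fun y => u (x + -y)) (by fun_prop) fun y => hM _)]
    refine setIntegral_congr_fun measurableSet_Ioi fun y hy => ?_
    simp only [hpow y hy, abs_neg, ← sub_eq_add_neg, add_div]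
  · have hneg : ∫ y in Ioi 0, (-deriv (deriv u) (x + y) - deriv (deriv u) (x - y)) * y ^ (1 - α) =
        -∫ y in Ioi 0, (h y + h (-y)) := by
      rw [← integral_neg]
      refine setIntegral_congr_fun measurableSet_Ioi fun y hy => ?_
      have hy : 0 < y := hy
      simp only [hh, abs_neg, abs_of_pos hy, ← sub_eq_add_neg]
      ring
    rw [hneg, hheq, hfold, show α * (1 - α) = -(α * (α - 1)) by ring, div_neg, neg_div]
    ring
end

section
/- Let α ∈ (0,1) and set c_α = α·2^(α−1)·Γ((1+α)/2)/(√π·Γ(1−α/2)). Let u : ℝ → ℝ be twice continuously differentiable with u, u′ and u″ bounded, suppose u′(x) → 0 as x → +∞ and as x → −∞, and let x ∈ ℝ be such that the function y ↦ u″(y)·|x−y|^(1−α) is Lebesgue integrable on ℝ. Then the function y ↦ (u(x)−u(x+y))/|y|^(1+α) is Lebesgue integrable on ℝ and c_α ∫_ℝ (u(x)−u(x+y))/|y|^(1+α) dy = (c_α/(α(1−α))) ∫_ℝ u″(y)·|x−y|^(1−α) dy. -/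
open MeasureTheory Filter Set Real

theorem integrableOn_Ioi_sub_div_rpow {α : ℝ} (hα : α ∈ Ioo (0 : ℝ) 1) {w w' : ℝ → ℝ} {M M' : ℝ}
    (hw : ∀ t, HasDerivAt w (w' t) t) (hM : ∀ t, |w t| ≤ M) (hM' : ∀ t, |w' t| ≤ M') :
    IntegrableOn (fun t => (w 0 - w t) / |t| ^ (1 + α)) (Ioi 0) := by
  obtain ⟨h0, h1⟩ := hα
  have hcont : Continuous w := continuous_iff_continuousAt.2 fun t => (hw t).continuousAt
  have hmeas : Measurable fun t => (w 0 - w t) / |t| ^ (1 + α) :=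
    (measurable_const.sub hcont.measurable).div (measurable_id.abs.pow_const _)
  rw [← Ioc_union_Ioi_eq_Ioi (zero_le_one (α := ℝ))]
  refine IntegrableOn.union ?_ ?_
  · have hi : IntegrableOn (fun t : ℝ => M' * t ^ (-α)) (Ioc 0 1) :=
      ((intervalIntegrable_iff_integrableOn_Ioc_of_le zero_le_one).1
        (intervalIntegral.intervalIntegrable_rpow' (by linarith))).const_mul M'
    refine hi.mono' hmeas.aestronglyMeasurable ?_
    filter_upwards [ae_restrict_mem measurableSet_Ioc] with t ht
    have hb := convex_univ.norm_image_sub_le_of_norm_hasDerivWithin_le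
      (fun s _ => (hw s).hasDerivWithinAt) (fun s _ => hM' s) (mem_univ t) (mem_univ 0)
    rw [zero_sub, norm_neg, Real.norm_of_nonneg ht.1.le] at hb
    rw [norm_div, abs_of_pos ht.1, Real.norm_of_nonneg (rpow_nonneg ht.1.le (1 + α)),
      div_le_iff₀ (rpow_pos_of_pos ht.1 _), mul_assoc, ← rpow_add ht.1]
    simpa using hb
  · refine ((integrableOn_Ioi_rpow_of_lt (a := -(1 + α)) (by linarith) one_pos).const_mul
      (M + M)).mono' hmeas.aestronglyMeasurable ?_
    filter_upwards [ae_restrict_mem measurableSet_Ioi] with t ht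
    have ht0 : 0 < t := one_pos.trans ht
    rw [norm_div, abs_of_pos ht0, Real.norm_of_nonneg (rpow_nonneg ht0.le (1 + α)),
      rpow_neg ht0.le, ← div_eq_mul_inv]
    gcongr
    exact (norm_sub_le _ _).trans (add_le_add (hM 0) (hM t))

theorem tendsto_mul_rpow_atTop_zero {β : ℝ} (hβ : 0 ≤ β) {v v' : ℝ → ℝ}
    (hv : ∀ t, HasDerivAt v (v' t) t) (hv' : Continuous v') (hlim : Tendsto v atTop (nhds 0))
    (hint : IntegrableOn (fun t => v' t * t ^ β) (Ioi 0)) :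
    Tendsto (fun t => v t * t ^ β) atTop (nhds 0) := by
  have htail := tendsto_integral_Ioi_zero (l := atTop) (b := id) (μ := volume)
    (f := fun t => ‖v' t * t ^ β‖) tendsto_id
  refine squeeze_zero_norm' ?_ htail
  filter_upwards [eventually_gt_atTop 0] with t ht
  have htβ : 0 < t ^ β := rpow_pos_of_pos ht β
  have hsub : IntegrableOn (fun s => ‖v' s * s ^ β‖) (Ioi t) :=
    (hint.mono_set (Ioi_subset_Ioi ht.le)).norm
  have hle : ∀ s ∈ Ioi t, ‖v' s‖ * t ^ β ≤ ‖v' s * s ^ β‖ := fun s hs => by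
    have hs' : t < s := hs
    rw [norm_mul, Real.norm_of_nonneg (rpow_nonneg (ht.trans hs').le β)]
    gcongr
  have hmul : IntegrableOn (fun s => ‖v' s‖ * t ^ β) (Ioi t) := by
    refine hsub.mono' (hv'.norm.mul continuous_const).aestronglyMeasurable ?_
    filter_upwards [ae_restrict_mem measurableSet_Ioi] with s hs
    rw [Real.norm_of_nonneg (by positivity)]
    exact hle s hs
  have hv'int : IntegrableOn v' (Ioi t) := by
    refine (integrable_norm_iff hv'.aestronglyMeasurable).1 ?_
    simpa [htβ.ne'] using hmul.mul_const (t ^ β)⁻¹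
  have hftc := integral_Ioi_of_hasDerivAt_of_tendsto' (fun s _ => hv s) hv'int hlim
  have hvt : ‖v t‖ ≤ ∫ s in Ioi t, ‖v' s‖ := by
    rw [← norm_neg, ← zero_sub, ← hftc]
    exact norm_integral_le_integral_norm _
  calc ‖v t * t ^ β‖ = ‖v t‖ * t ^ β := by rw [norm_mul, Real.norm_of_nonneg htβ.le]
    _ ≤ (∫ s in Ioi t, ‖v' s‖) * t ^ β := by gcongr
    _ = ∫ s in Ioi t, ‖v' s‖ * t ^ β := (integral_mul_const _ _).symm
    _ ≤ ∫ s in Ioi t, ‖v' s * s ^ β‖ := setIntegral_mono_on hmul hsub measurableSet_Ioi hle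

theorem integral_Ioi_sub_div_rpow {α : ℝ} (hα : α ∈ Ioo (0 : ℝ) 1) {w w' w'' : ℝ → ℝ} {M M' : ℝ}
    (hw : ∀ t, HasDerivAt w (w' t) t) (hw' : ∀ t, HasDerivAt w' (w'' t) t)
    (hw'' : Continuous w'') (hM : ∀ t, |w t| ≤ M) (hM' : ∀ t, |w' t| ≤ M')
    (hlim : Tendsto w' atTop (nhds 0))
    (hint : IntegrableOn (fun t => w'' t * |t| ^ (1 - α)) (Ioi 0)) :
    ∫ t in Ioi 0, (w 0 - w t) / |t| ^ (1 + α) =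
      (α * (1 - α))⁻¹ * ∫ t in Ioi 0, w'' t * |t| ^ (1 - α) := by
  have hI := integrableOn_Ioi_sub_div_rpow hα hw hM hM'
  obtain ⟨h0, h1⟩ := hα
  have h1' : 0 < 1 - α := sub_pos.2 h1
  have hint' : IntegrableOn (fun t => w'' t * t ^ (1 - α)) (Ioi 0) :=
    hint.congr_fun (fun t ht => by simp only [abs_of_pos (mem_Ioi.1 ht)]) measurableSet_Ioi
  set F : ℝ → ℝ := fun t =>
    -(α⁻¹ * ((w 0 - w t) * t ^ (-α))) - (α * (1 - α))⁻¹ * (w' t * t ^ (1 - α)) with hF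
  have hF0 : F 0 = 0 := by simp [hF, zero_rpow h1'.ne']
  have hderiv : ∀ t ∈ Ioi (0 : ℝ), HasDerivAt F
      ((w 0 - w t) / |t| ^ (1 + α) - (α * (1 - α))⁻¹ * (w'' t * |t| ^ (1 - α))) t := by
    intro t ht
    have ht0 : 0 < t := ht
    have hd := (((((hw t).const_sub (w 0)).mul
      (hasDerivAt_rpow_const (p := -α) (Or.inl ht0.ne'))).const_mul α⁻¹).neg).sub
      (((hw' t).mul (hasDerivAt_rpow_const (p := 1 - α) (Or.inl ht0.ne'))).const_mul
        (α * (1 - α))⁻¹)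
    refine hd.congr_deriv ?_
    rw [abs_of_pos ht0, show 1 - α - 1 = -α by ring, show -α - 1 = -(1 + α) by ring,
      rpow_neg ht0.le (1 + α)]
    field_simp
    ring
  have hcont : ContinuousWithinAt F (Ici 0) 0 := by
    have hlim0 : Tendsto (fun t : ℝ => (α⁻¹ * M' + (α * (1 - α))⁻¹ * M') * t ^ (1 - α))
        (nhdsWithin 0 (Ici 0)) (nhds 0) := by
      have := ((continuousAt_rpow_const 0 (1 - α) (Or.inr h1'.le)).tendsto.const_mul
        (α⁻¹ * M' + (α * (1 - α))⁻¹ * M')).mono_left (nhdsWithin_le_nhds (s := Ici 0))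
      simpa [zero_rpow h1'.ne'] using this
    rw [ContinuousWithinAt, hF0]
    refine squeeze_zero_norm' ?_ hlim0
    filter_upwards [self_mem_nhdsWithin] with t ht
    rcases (mem_Ici.1 ht).eq_or_lt with rfl | ht0
    · simp [hF0, zero_rpow h1'.ne']
    have hb := convex_univ.norm_image_sub_le_of_norm_hasDerivWithin_le
      (fun s _ => (hw s).hasDerivWithinAt) (fun s _ => hM' s) (mem_univ t) (mem_univ 0)
    rw [zero_sub, norm_neg, Real.norm_of_nonneg ht0.le] at hb
    calc ‖F t‖ ≤ α⁻¹ * (‖w 0 - w t‖ * t ^ (-α)) +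
          (α * (1 - α))⁻¹ * (‖w' t‖ * t ^ (1 - α)) := by
          refine (norm_sub_le _ _).trans_eq ?_
          have hp : (0 : ℝ) ≤ (α * (1 - α))⁻¹ := by positivity
          rw [norm_neg, norm_mul, norm_mul, norm_mul, norm_mul, Real.norm_of_nonneg hp,
            Real.norm_of_nonneg (inv_nonneg.2 h0.le), Real.norm_of_nonneg (rpow_nonneg ht0.le _),
            Real.norm_of_nonneg (rpow_nonneg ht0.le _)]
      _ ≤ α⁻¹ * (M' * t * t ^ (-α)) + (α * (1 - α))⁻¹ * (M' * t ^ (1 - α)) := by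
          gcongr
          exact hM' t
      _ = _ := by
          rw [sub_eq_add_neg, rpow_add ht0, rpow_one]
          ring
  have htop : Tendsto F atTop (nhds 0) := by
    have hA : Tendsto (fun t => (w 0 - w t) * t ^ (-α)) atTop (nhds 0) := by
      have hz := (tendsto_rpow_neg_atTop h0).const_mul (M + M)
      rw [mul_zero] at hz
      refine squeeze_zero_norm' ?_ hz
      filter_upwards [eventually_gt_atTop 0] with t ht
      rw [norm_mul, Real.norm_of_nonneg (rpow_nonneg ht.le (-α))]
      gcongr
      exact (norm_sub_le _ _).trans (add_le_add (hM 0) (hM t))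
    have hB := tendsto_mul_rpow_atTop_zero h1'.le hw' hw'' hlim hint'
    have hAB := ((hA.const_mul α⁻¹).neg).sub (hB.const_mul (α * (1 - α))⁻¹)
    rwa [mul_zero, mul_zero, neg_zero, sub_zero] at hAB
  have hftc := integral_Ioi_of_hasDerivAt_of_tendsto hcont hderiv
    (hI.sub (hint.const_mul _)) htop
  rw [integral_sub hI (hint.const_mul _), integral_const_mul, hF0, sub_zero] at hftc
  exact sub_eq_zero.1 hftc

theorem integrableOn_Iic_of_comp_neg {f : ℝ → ℝ}
    (h : IntegrableOn (fun t => f (-t)) (Ioi 0)) : IntegrableOn f (Iic 0) := by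
  rw [integrableOn_Iic_iff_integrableOn_Iio]
  refine ((Measure.measurePreserving_neg volume).integrableOn_comp_preimage
    (Homeomorph.neg ℝ).measurableEmbedding).1 ?_
  simpa [Function.comp_def] using h

theorem integral_eq_integral_Ioi_comp_neg_add {f : ℝ → ℝ} (hf : Integrable f) :
    ∫ t, f t = (∫ t in Ioi 0, f (-t)) + ∫ t in Ioi 0, f t := by
  rw [integral_comp_neg_Ioi, neg_zero,
    intervalIntegral.integral_Iic_add_Ioi hf.integrableOn hf.integrableOn]

/-- Case α ∈ (0,1) of Lemma 1. -/
theorem stmt_2 (α : ℝ) (hα : α ∈ Set.Ioo (0:ℝ) 1)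
    (u : ℝ → ℝ) (hu : ContDiff ℝ 2 u)
    (hub : ∃ M, ∀ y, |u y| ≤ M)
    (hub' : ∃ M, ∀ y, |deriv u y| ≤ M)
    (hub'' : ∃ M, ∀ y, |deriv (deriv u) y| ≤ M)
    (hlim_top : Tendsto (deriv u) atTop (nhds 0))
    (hlim_bot : Tendsto (deriv u) atBot (nhds 0))
    (x : ℝ)
    (hint : Integrable (fun y => deriv (deriv u) y * |x - y| ^ (1 - α))) :
    Integrable (fun y : ℝ => (u x - u (x + y)) / |y| ^ (1 + α)) ∧
    (α * 2 ^ (α - 1) * Real.Gamma ((1 + α) / 2) / (Real.sqrt π * Real.Gamma (1 - α / 2)))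
        * ∫ y : ℝ, (u x - u (x + y)) / |y| ^ (1 + α)
      = (α * 2 ^ (α - 1) * Real.Gamma ((1 + α) / 2) / (Real.sqrt π * Real.Gamma (1 - α / 2)))
          / (α * (1 - α)) * ∫ y : ℝ, deriv (deriv u) y * |x - y| ^ (1 - α) := by
  obtain ⟨M, hM⟩ := hub
  obtain ⟨M', hM'⟩ := hub'
  have hu' : ContDiff ℝ 1 (deriv u) := ((contDiff_succ_iff_deriv (n := 1)).1 hu).2.2
  have hd : ∀ t, HasDerivAt u (deriv u t) t := fun t =>
    (hu.differentiable two_ne_zero t).hasDerivAt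
  have hd' : ∀ t, HasDerivAt (deriv u) (deriv (deriv u) t) t := fun t =>
    (hu'.differentiable one_ne_zero t).hasDerivAt
  have hcont : Continuous (deriv (deriv u)) := hu'.continuous_deriv le_rfl
  have hwp : ∀ t, HasDerivAt (fun s => u (x + s)) (deriv u (x + t)) t := fun t =>
    (hd (x + t)).comp_const_add x t
  have hwp' : ∀ t, HasDerivAt (fun s => deriv u (x + s)) (deriv (deriv u) (x + t)) t := fun t =>
    (hd' (x + t)).comp_const_add x t
  have hwn : ∀ t, HasDerivAt (fun s => u (x + -s)) (-deriv u (x + -t)) t := fun t => by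
    simpa [Function.comp_def] using! (hwp (-t)).comp t (hasDerivAt_neg t)
  have hwn' : ∀ t, HasDerivAt (fun s => -deriv u (x + -s)) (deriv (deriv u) (x + -t)) t :=
    fun t => by
      simpa [Function.comp_def] using! ((hwp' (-t)).comp t (hasDerivAt_neg t)).neg
  set f : ℝ → ℝ := fun y => (u x - u (x + y)) / |y| ^ (1 + α) with hf
  set g : ℝ → ℝ := fun y => deriv (deriv u) (x + y) * |y| ^ (1 - α) with hg
  have hgint : Integrable g := by simpa [hg] using hint.comp_add_left x
  have hgeq : ∫ y, deriv (deriv u) y * |x - y| ^ (1 - α) = ∫ y, g y := by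
    rw [← integral_add_left_eq_self _ x]
    simp [hg]
  have hfp : IntegrableOn f (Ioi 0) := by
    simpa using integrableOn_Ioi_sub_div_rpow hα hwp (fun t => hM _) (fun t => hM' _)
  have hfn : IntegrableOn (fun t => f (-t)) (Ioi 0) := by
    simpa [hf] using integrableOn_Ioi_sub_div_rpow hα hwn (fun t => hM _)
      (fun t => (abs_neg _).trans_le (hM' _))
  have hfint : Integrable f := by
    rw [← integrableOn_univ, ← Iic_union_Ioi (a := (0 : ℝ))]
    exact (integrableOn_Iic_of_comp_neg hfn).union hfp
  have hp : ∫ t in Ioi 0, f t = (α * (1 - α))⁻¹ * ∫ t in Ioi 0, g t := by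
    simpa using integral_Ioi_sub_div_rpow hα hwp hwp' (by fun_prop) (fun t => hM _)
      (fun t => hM' _) (hlim_top.comp (tendsto_atTop_add_const_left _ x tendsto_id))
      hgint.integrableOn
  have hn : ∫ t in Ioi 0, f (-t) = (α * (1 - α))⁻¹ * ∫ t in Ioi 0, g (-t) := by
    have hlim : Tendsto (fun t => -deriv u (x + -t)) atTop (nhds 0) := by
      simpa using (hlim_bot.comp
        (tendsto_atBot_add_const_left _ x tendsto_neg_atTop_atBot)).neg
    simpa [hf, hg] using integral_Ioi_sub_div_rpow hα hwn hwn' (by fun_prop) (fun t => hM _)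
      (fun t => (abs_neg _).trans_le (hM' _)) hlim
      (by simpa [hg] using hgint.comp_neg.integrableOn (s := Ioi 0))
  refine ⟨hfint, ?_⟩
  rw [hgeq, integral_eq_integral_Ioi_comp_neg_add hfint,
    integral_eq_integral_Ioi_comp_neg_add hgint, hp, hn]
  ring
end

section
/- Let k be a nonzero even integer and let s ∈ (0,π). Then the principal-value limit lim_{ε→0⁺} ∫_{{η ∈ (0,π) : |η−s| > ε}} sin(η)·e^{ikη}/sin(s−η) dη exists and equals −iπ·sgn(k)·sin(s)·e^{iks}. -/
open MeasureTheory Filter Set Real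

theorem tendsto_integral_symm_truncation {g : ℝ → ℂ} (hg : Continuous g) :
    Tendsto (fun ε : ℝ => ∫ t in ε..(π - ε), g t) (nhdsWithin 0 (Set.Ioi 0))
      (nhds (∫ t in (0 : ℝ)..π, g t)) := by
  have hi : ∀ a b : ℝ, IntervalIntegrable g volume a b := fun a b => hg.intervalIntegrable a b
  have hp : Continuous fun x : ℝ => ∫ t in (0 : ℝ)..x, g t :=
    intervalIntegral.continuous_primitive hi 0
  have hc : Continuous fun ε : ℝ => ∫ t in ε..(π - ε), g t := by
    have : (fun ε : ℝ => ∫ t in ε..(π - ε), g t)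
        = fun ε => (∫ t in (0 : ℝ)..(π - ε), g t) - ∫ t in (0 : ℝ)..ε, g t := by
      funext ε
      rw [intervalIntegral.integral_interval_sub_left (hi _ _) (hi _ _)]
    rw [this]
    exact (hp.comp (continuous_const.sub continuous_id)).sub hp
  have h := hc.tendsto 0
  simp only [sub_zero] at h
  exact h.mono_left nhdsWithin_le_nhds

theorem integral_exp_two_mul_int (m : ℤ) :
    ∫ t in (0 : ℝ)..π, Complex.exp (2 * m * Complex.I * t) = if m = 0 then (π : ℂ) else 0 := by
  split_ifs with hm
  · simp [hm]
  · have hc : (2 * m * Complex.I : ℂ) ≠ 0 := by simp [hm]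
    rw [integral_exp_mul_complex hc]
    have : Complex.exp (2 * m * Complex.I * (π : ℂ)) = 1 := by
      rw [← Complex.exp_int_mul_two_pi_mul_I m]
      congr 1
      ring
    simp [this]

theorem continuous_exp_two_mul_int (m : ℤ) :
    Continuous fun t : ℝ => Complex.exp (2 * m * Complex.I * t) := by fun_prop

theorem intervalIntegrable_cot_mul {g : ℝ → ℂ} (hg : Continuous g) {ε : ℝ}
    (h0 : 0 < ε) (h1 : ε < π / 2) :
    IntervalIntegrable (fun t : ℝ => ((Real.cos t / Real.sin t : ℝ) : ℂ) * g t) volume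
      ε (π - ε) := by
  apply ContinuousOn.intervalIntegrable
  rw [uIcc_of_le (by linarith)]
  refine ContinuousOn.mul (Complex.continuous_ofReal.comp_continuousOn ?_) hg.continuousOn
  refine Real.continuous_cos.continuousOn.div Real.continuous_sin.continuousOn fun t ht => ?_
  exact (Real.sin_pos_of_pos_of_lt_pi (by linarith [ht.1]) (by linarith [ht.2])).ne'

theorem integral_cot_symm (ε : ℝ) :
    ∫ t in ε..(π - ε), ((Real.cos t / Real.sin t : ℝ) : ℂ) = 0 := by
  have h := intervalIntegral.integral_comp_sub_left (a := ε) (b := π - ε)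
    (fun t : ℝ => ((Real.cos t / Real.sin t : ℝ) : ℂ)) π
  simp only [Real.cos_pi_sub, Real.sin_pi_sub, neg_div, Complex.ofReal_neg,
    intervalIntegral.integral_neg, sub_sub_cancel] at h
  exact self_eq_neg.mp h.symm

theorem cot_mul_exp_succ (m : ℤ) {t : ℝ} (ht : Real.sin t ≠ 0) :
    ((Real.cos t / Real.sin t : ℝ) : ℂ) * Complex.exp (2 * (m + 1 : ℤ) * Complex.I * t)
      = ((Real.cos t / Real.sin t : ℝ) : ℂ) * Complex.exp (2 * m * Complex.I * t)
        + Complex.I * (Complex.exp (2 * (m + 1 : ℤ) * Complex.I * t)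
          + Complex.exp (2 * m * Complex.I * t)) := by
  have hs : (Complex.sin t) ≠ 0 := by exact_mod_cast ht
  have h1 : Complex.exp (2 * (m + 1 : ℤ) * Complex.I * t)
      = Complex.exp (2 * m * Complex.I * t)
        * (Complex.cos t + Complex.sin t * Complex.I) ^ 2 := by
    rw [← Complex.exp_mul_I, ← Complex.exp_nat_mul, ← Complex.exp_add]
    congr 1
    push_cast
    ring
  rw [h1]
  push_cast
  field_simp
  have h2 := Complex.sin_sq_add_cos_sq (t : ℂ)
  have h3 : Complex.cos t ^ 2 = 1 - Complex.sin t ^ 2 := by linear_combination h2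
  have hI := Complex.I_sq
  grind

theorem tendsto_integral_cot_mul_exp (m : ℤ) :
    Tendsto (fun ε : ℝ => ∫ t in ε..(π - ε),
        ((Real.cos t / Real.sin t : ℝ) : ℂ) * Complex.exp (2 * m * Complex.I * t))
      (nhdsWithin 0 (Set.Ioi 0)) (nhds (Complex.I * π * (Int.sign m : ℂ))) := by
  have hsmall : ∀ᶠ ε : ℝ in nhdsWithin 0 (Set.Ioi 0), 0 < ε ∧ ε < π / 2 :=
    Ioo_mem_nhdsGT (by positivity)
  have hrec : ∀ n : ℤ, ∀ᶠ ε : ℝ in nhdsWithin 0 (Set.Ioi 0),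
      (∫ t in ε..(π - ε), ((Real.cos t / Real.sin t : ℝ) : ℂ)
          * Complex.exp (2 * (n + 1 : ℤ) * Complex.I * t))
        = (∫ t in ε..(π - ε), ((Real.cos t / Real.sin t : ℝ) : ℂ)
          * Complex.exp (2 * n * Complex.I * t))
        + ∫ t in ε..(π - ε), Complex.I * (Complex.exp (2 * (n + 1 : ℤ) * Complex.I * t)
          + Complex.exp (2 * n * Complex.I * t)) := by
    intro n
    filter_upwards [hsmall] with ε hε
    rw [← intervalIntegral.integral_add
      (intervalIntegrable_cot_mul (continuous_exp_two_mul_int n) hε.1 hε.2)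
      (Continuous.intervalIntegrable (by fun_prop) _ _)]
    apply intervalIntegral.integral_congr
    intro t ht
    rw [uIcc_of_le (by linarith [hε.2])] at ht
    exact cot_mul_exp_succ n
      (Real.sin_pos_of_pos_of_lt_pi (by linarith [ht.1, hε.1]) (by linarith [ht.2, hε.1])).ne'
  have hstep : ∀ n : ℤ, Tendsto (fun ε : ℝ => ∫ t in ε..(π - ε),
        Complex.I * (Complex.exp (2 * (n + 1 : ℤ) * Complex.I * t)
          + Complex.exp (2 * n * Complex.I * t)))
      (nhdsWithin 0 (Set.Ioi 0))
      (nhds (Complex.I * π * (Int.sign (n + 1) : ℂ) - Complex.I * π * (Int.sign n : ℂ))) := by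
    intro n
    convert tendsto_integral_symm_truncation (g := fun t : ℝ =>
      Complex.I * (Complex.exp (2 * (n + 1 : ℤ) * Complex.I * t)
          + Complex.exp (2 * n * Complex.I * t))) (by fun_prop) using 2
    rw [intervalIntegral.integral_const_mul, intervalIntegral.integral_add
      ((continuous_exp_two_mul_int _).intervalIntegrable _ _)
      ((continuous_exp_two_mul_int _).intervalIntegrable _ _),
      integral_exp_two_mul_int, integral_exp_two_mul_int]
    rcases lt_trichotomy n 0 with h | rfl | h
    · rcases eq_or_ne n (-1) with rfl | h'
      · simp
      · rw [Int.sign_eq_neg_one_of_neg h, Int.sign_eq_neg_one_of_neg (by omega),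
          if_neg (by omega), if_neg (by omega)]
        simp
    · simp
    · rw [Int.sign_eq_one_of_pos h, Int.sign_eq_one_of_pos (by omega),
          if_neg (by omega), if_neg (by omega)]
      simp
  induction m using Int.induction_on with
  | zero =>
    simp only [Int.cast_zero, mul_zero, zero_mul, Complex.exp_zero, mul_one, integral_cot_symm,
      Int.sign_zero]
    exact tendsto_const_nhds
  | succ n ih =>
    have h := ih.add (hstep n)
    rw [add_sub_cancel] at h
    exact h.congr' ((hrec n).mono fun ε hε => hε.symm)
  | pred n ih =>
    have h := ih.sub (hstep (-n - 1))
    have hr := hrec (-n - 1)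
    simp only [sub_add_cancel, sub_sub_cancel] at h hr
    exact h.congr' (hr.mono fun ε hε => sub_eq_of_eq_add hε)

theorem setIntegral_symm_truncation_eq {F : ℝ → ℂ} {s ε : ℝ} (h0 : 0 < ε) (hs : ε < s)
    (hs' : ε < π - s) (hF : ContinuousOn F (Set.Ioo s (s + π))) (hper : ∀ x, F (x + π) = F x) :
    ∫ η in {η : ℝ | η ∈ Set.Ioo 0 π ∧ ε < |η - s|}, F η
      = ∫ t in ε..(π - ε), F (t + s) := by
  have hset : {η : ℝ | η ∈ Set.Ioo 0 π ∧ ε < |η - s|} = Ioo 0 (s - ε) ∪ Ioo (s + ε) π := by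
    ext η
    simp only [mem_ofPred_eq, mem_Ioo, mem_union, lt_abs]
    constructor
    · rintro ⟨⟨h1, h2⟩, h | h⟩
      · right; constructor <;> linarith
      · left; constructor <;> linarith
    · rintro (⟨h1, h2⟩ | ⟨h1, h2⟩)
      · exact ⟨⟨h1, by linarith⟩, Or.inr (by linarith)⟩
      · exact ⟨⟨by linarith, h2⟩, Or.inl (by linarith)⟩
  have hi1 : IntervalIntegrable F volume (s + ε) π := by
    apply ContinuousOn.intervalIntegrable
    rw [uIcc_of_le (by linarith)]
    exact hF.mono fun x hx => ⟨by linarith [hx.1], by linarith [hx.2]⟩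
  have hi2 : IntervalIntegrable F volume π (s - ε + π) := by
    apply ContinuousOn.intervalIntegrable
    rw [uIcc_of_le (by linarith)]
    exact hF.mono fun x hx => ⟨by linarith [hx.1], by linarith [hx.2]⟩
  have hi3 : IntervalIntegrable F volume 0 (s - ε) := by
    have h := hi2.comp_add_right π
    simpa only [hper, sub_self, add_sub_cancel_right] using h
  have hshift : ∫ x in (0 : ℝ)..(s - ε), F x = ∫ x in π..(s - ε + π), F x := by
    have h := intervalIntegral.integral_comp_add_right (a := 0) (b := s - ε) F π
    simpa only [hper, zero_add] using h
  rw [hset, setIntegral_union _ measurableSet_Ioo, ← integral_Ioc_eq_integral_Ioo,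
    ← integral_Ioc_eq_integral_Ioo, ← intervalIntegral.integral_of_le (by linarith),
    ← intervalIntegral.integral_of_le (by linarith), hshift, add_comm,
    intervalIntegral.integral_add_adjacent_intervals hi1 hi2,
    intervalIntegral.integral_comp_add_right F s]
  · congr 1 <;> ring
  · exact ((intervalIntegrable_iff_integrableOn_Ioo_of_le (by linarith)).1 hi3)
  · exact ((intervalIntegrable_iff_integrableOn_Ioo_of_le (by linarith)).1 hi1)
  · rw [Set.disjoint_left]
    intro x hx hx'
    linarith [hx.2, hx'.1]

/-- Identity (20) of the paper for even k ≠ 0. -/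
theorem stmt_4 (k : ℤ) (hk : k ≠ 0) (hke : Even k) (s : ℝ) (hs : s ∈ Set.Ioo 0 π) :
    Tendsto (fun ε : ℝ => ∫ η in {η : ℝ | η ∈ Set.Ioo 0 π ∧ ε < |η - s|},
        (Real.sin η : ℂ) * Complex.exp (Complex.I * (k : ℂ) * (η : ℂ)) / (Real.sin (s - η) : ℂ))
      (nhdsWithin 0 (Set.Ioi 0))
      (nhds (-Complex.I * (π : ℂ) * (Int.sign k : ℂ) * (Real.sin s : ℂ)
        * Complex.exp (Complex.I * (k : ℂ) * (s : ℂ)))) := by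
  obtain ⟨m, rfl⟩ := hke.two_dvd
  have hm : m ≠ 0 := by rintro rfl; simp at hk
  have hsign : Int.sign (2 * m) = Int.sign m := by
    rw [Int.sign_mul, show Int.sign 2 = 1 from rfl, one_mul]
  have hE := tendsto_integral_symm_truncation (continuous_exp_two_mul_int m)
  rw [integral_exp_two_mul_int, if_neg hm] at hE
  have hL := ((tendsto_integral_cot_mul_exp m).const_mul (Real.sin s : ℂ)).add
    (hE.const_mul (Real.cos s : ℂ))
  have hlim := hL.const_mul (-Complex.exp (Complex.I * ((2 * m : ℤ) : ℂ) * (s : ℂ)))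
  rw [hsign]
  refine (hlim.congr' ?_).trans_eq ?_
  · filter_upwards [Ioo_mem_nhdsGT (show (0 : ℝ) < min (min s (π - s)) (π / 2) from
      lt_min (lt_min hs.1 (by linarith [hs.2])) (by positivity))] with ε hε
    obtain ⟨h0, hε⟩ := hε
    obtain ⟨hε, h3⟩ := lt_min_iff.1 hε
    obtain ⟨h1, h2⟩ := lt_min_iff.1 hε
    rw [setIntegral_symm_truncation_eq h0 h1 h2]
    · rw [← intervalIntegral.integral_const_mul, ← intervalIntegral.integral_const_mul,
        ← intervalIntegral.integral_add
          ((intervalIntegrable_cot_mul (continuous_exp_two_mul_int m) h0 h3).const_mul _)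
          (((continuous_exp_two_mul_int m).intervalIntegrable _ _).const_mul _),
        ← intervalIntegral.integral_const_mul]
      apply intervalIntegral.integral_congr
      intro t ht
      rw [uIcc_of_le (by linarith)] at ht
      have hsin : Complex.sin t ≠ 0 := by
        exact_mod_cast (Real.sin_pos_of_pos_of_lt_pi (by linarith [ht.1])
          (by linarith [ht.2])).ne'
      have hexp : Complex.exp (Complex.I * ((2 * m : ℤ) : ℂ) * ((t + s : ℝ) : ℂ))
          = Complex.exp (Complex.I * ((2 * m : ℤ) : ℂ) * (s : ℂ))
            * Complex.exp (2 * m * Complex.I * t) := by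
        rw [← Complex.exp_add]
        congr 1
        push_cast
        ring
      have hsub : Real.sin (s - (t + s)) = -Real.sin t := by
        rw [← Real.sin_neg]
        congr 1
        ring
      simp only [hexp, hsub, Real.sin_add]
      push_cast
      field_simp
      ring
    · refine ContinuousOn.div (by fun_prop) (by fun_prop) fun x hx => ?_
      have : 0 < Real.sin (x - s) :=
        Real.sin_pos_of_pos_of_lt_pi (by linarith [hx.1]) (by linarith [hx.2])
      rw [← neg_sub x s, Real.sin_neg]
      exact_mod_cast (neg_neg_of_pos this).ne
    · intro x
      have hexp : Complex.exp (Complex.I * ((2 * m : ℤ) : ℂ) * ((x + π : ℝ) : ℂ))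
          = Complex.exp (Complex.I * ((2 * m : ℤ) : ℂ) * (x : ℂ)) := by
        rw [← mul_one (Complex.exp (Complex.I * ((2 * m : ℤ) : ℂ) * (x : ℂ))),
          ← Complex.exp_int_mul_two_pi_mul_I m, ← Complex.exp_add]
        congr 1
        push_cast
        ring
      rw [hexp, Real.sin_add_pi, ← sub_sub, Real.sin_sub_pi]
      push_cast
      rw [neg_mul, neg_div_neg_eq]
  · congr 1
    ring
end

section
/- For every s ∈ (0,π), the principal-value limit lim_{ε→0⁺} ∫_{{η ∈ (0,π) : |η−s| > ε}} sin(η)/sin(s−η) dη exists and equals −π·cos(s). -/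
open MeasureTheory Filter Set Real

/-- Away from its poles, `η ↦ sin η / sin (s - η)` has the primitive
`η ↦ -cos s * η - sin s * log |sin (η - s)|`. -/
theorem hasDerivAt_primitive_sin_div_sin_sub {s x : ℝ} (h : Real.sin (x - s) ≠ 0) :
    HasDerivAt (fun η => -Real.cos s * η - Real.sin s * Real.log (Real.sin (η - s)))
      (Real.sin x / Real.sin (s - x)) x := by
  have h1 : HasDerivAt (fun η => Real.sin (η - s)) (Real.cos (x - s)) x := by
    simpa using ((hasDerivAt_id x).sub_const s).sin
  refine (((hasDerivAt_id x).const_mul (-Real.cos s)).sub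
    ((h1.log h).const_mul (Real.sin s))).congr_deriv ?_
  have h2 : Real.sin x = Real.sin (x - s) * Real.cos s + Real.cos (x - s) * Real.sin s := by
    rw [← Real.sin_add, sub_add_cancel]
  rw [← neg_sub x s, Real.sin_neg, h2]
  field_simp
  ring

theorem continuousOn_sin_div_sin_sub {s : ℝ} {t : Set ℝ}
    (h : ∀ x ∈ t, Real.sin (x - s) ≠ 0) :
    ContinuousOn (fun η => Real.sin η / Real.sin (s - η)) t := by
  refine ContinuousOn.div (by fun_prop) (by fun_prop) fun x hx => ?_
  rw [← neg_sub x s, Real.sin_neg]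
  exact neg_ne_zero.2 (h x hx)

theorem setIntegral_Ioo_sin_div_sin_sub {s a b : ℝ} (hab : a ≤ b)
    (h : ∀ x ∈ Set.Icc a b, Real.sin (x - s) ≠ 0) :
    ∫ η in Set.Ioo a b, Real.sin η / Real.sin (s - η) =
      (-Real.cos s * b - Real.sin s * Real.log (Real.sin (b - s))) -
        (-Real.cos s * a - Real.sin s * Real.log (Real.sin (a - s))) := by
  rw [← integral_Ioc_eq_integral_Ioo, ← intervalIntegral.integral_of_le hab]
  rw [← Set.uIcc_of_le hab] at h
  exact intervalIntegral.integral_eq_sub_of_hasDerivAt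
    (fun x hx => hasDerivAt_primitive_sin_div_sin_sub (h x hx))
    (continuousOn_sin_div_sin_sub h).intervalIntegrable

theorem integral_truncated_sin_div_sin_sub {s ε : ℝ} (hε : 0 < ε) (h1 : ε < s)
    (h2 : ε < π - s) :
    ∫ η in {η : ℝ | η ∈ Set.Ioo 0 π ∧ ε < |η - s|}, Real.sin η / Real.sin (s - η) =
      -π * Real.cos s + 2 * ε * Real.cos s := by
  have hset : {η : ℝ | η ∈ Set.Ioo 0 π ∧ ε < |η - s|} =
      Set.Ioo 0 (s - ε) ∪ Set.Ioo (s + ε) π := by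
    ext η
    simp only [Set.mem_ofPred_eq, Set.mem_Ioo, Set.mem_union, lt_abs]
    grind
  have hl : ∀ x ∈ Set.Icc 0 (s - ε), Real.sin (x - s) ≠ 0 := fun x hx =>
    (Real.sin_neg_of_neg_of_neg_pi_lt (by linarith [hx.2]) (by linarith [hx.1])).ne
  have hr : ∀ x ∈ Set.Icc (s + ε) π, Real.sin (x - s) ≠ 0 := fun x hx =>
    (Real.sin_pos_of_pos_of_lt_pi (by linarith [hx.1]) (by linarith [hx.2])).ne'
  have hdisj : Disjoint (Set.Ioo 0 (s - ε)) (Set.Ioo (s + ε) π) :=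
    Set.disjoint_left.2 fun x hx hx' => by linarith [hx.2, hx'.1]
  rw [hset, setIntegral_union hdisj measurableSet_Ioo
      ((continuousOn_sin_div_sin_sub hl).integrableOn_Icc.mono_set Set.Ioo_subset_Icc_self)
      ((continuousOn_sin_div_sin_sub hr).integrableOn_Icc.mono_set Set.Ioo_subset_Icc_self),
    setIntegral_Ioo_sin_div_sin_sub (by linarith) hl,
    setIntegral_Ioo_sin_div_sin_sub (by linarith) hr,
    show s - ε - s = -ε by ring, show s + ε - s = ε by ring, zero_sub, Real.sin_neg,
    Real.sin_neg, Real.log_neg_eq_log, Real.log_neg_eq_log, Real.sin_pi_sub]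
  ring

/-- The k = 0 case of identity (20) of the paper. -/
theorem stmt_5 (s : ℝ) (hs : s ∈ Set.Ioo 0 π) :
    Tendsto (fun ε : ℝ => ∫ η in {η : ℝ | η ∈ Set.Ioo 0 π ∧ ε < |η - s|},
        Real.sin η / Real.sin (s - η))
      (nhdsWithin 0 (Set.Ioi 0)) (nhds (-π * Real.cos s)) := by
  have hlim : Tendsto (fun ε : ℝ => -π * Real.cos s + 2 * ε * Real.cos s)
      (nhdsWithin 0 (Set.Ioi 0)) (nhds (-π * Real.cos s)) := by
    refine Tendsto.mono_left ?_ nhdsWithin_le_nhds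
    have hc : Continuous fun ε : ℝ => -π * Real.cos s + 2 * ε * Real.cos s := by fun_prop
    simpa using hc.tendsto 0
  refine hlim.congr' ?_
  filter_upwards [Ioo_mem_nhdsGT (lt_min hs.1 (sub_pos.2 hs.2))] with ε hε
  exact (integral_truncated_sin_div_sin_sub hε.1 (hε.2.trans_le (min_le_left _ _))
    (hε.2.trans_le (min_le_right _ _))).symm
end

section
/- Let k be an odd integer. For each s ∈ (0,π) the principal-value limit G(s) := lim_{ε→0⁺} ∫_{{η ∈ (0,π) : |η−s| > ε}} sin(η)·e^{ikη}/sin(s−η) dη exists, and for every integer l the Fourier coefficient c_{k,l} := (1/π) ∫_0^π sin(s)·G(s)·e^{−2ils} ds is given by: c_{k,0} = −2/(k²−4), and c_{k,l} = −4·sgn(l)/((k−2l)·((k−2l)²−4)) for l ≠ 0. (Since k is odd, all the denominators are nonzero.) -/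
open MeasureTheory Filter Set Real intervalIntegral

/-- The domain `(0, π)` with a symmetric neighbourhood of `s` removed. -/
def truncatedDomain (s ε : ℝ) : Set ℝ := {η : ℝ | η ∈ Set.Ioo 0 π ∧ ε < |η - s|}

lemma sin_sub_ne_zero_of_mem {s η : ℝ} (hs : s ∈ Ioo 0 π) (hη : η ∈ Icc 0 π) (h : η ≠ s) :
    Real.sin (s - η) ≠ 0 := by
  obtain ⟨h1, h2⟩ := hs
  obtain ⟨h3, h4⟩ := hη
  rcases lt_or_gt_of_ne h with h | h
  · exact (Real.sin_pos_of_pos_of_lt_pi (by linarith) (by linarith)).ne'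
  · exact (Real.sin_neg_of_neg_of_neg_pi_lt (by linarith) (by linarith)).ne

lemma ne_of_mem_truncatedDomain {s ε η : ℝ} (hε : 0 < ε) (h : η ∈ truncatedDomain s ε) :
    η ≠ s := by
  rintro rfl
  have := h.2
  simp at this
  linarith

lemma measurableSet_truncatedDomain (s ε : ℝ) : MeasurableSet (truncatedDomain s ε) :=
  measurableSet_Ioo.inter
    (isOpen_lt continuous_const (continuous_id.sub continuous_const).abs).measurableSet

lemma integrableOn_div_sin_sub {s ε : ℝ} (hs : s ∈ Ioo 0 π) (hε : 0 < ε) {f : ℝ → ℂ}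
    (hf : Continuous f) :
    IntegrableOn (fun η => f η / (Real.sin (s - η) : ℂ)) (truncatedDomain s ε) := by
  have hK : IsCompact (Icc 0 π ∩ {η : ℝ | ε ≤ |η - s|}) :=
    isCompact_Icc.inter_right
      (isClosed_le continuous_const (continuous_id.sub continuous_const).abs)
  refine (ContinuousOn.integrableOn_compact hK ?_).mono_set ?_
  · refine hf.continuousOn.div (by fun_prop) fun η hη => ?_
    refine Complex.ofReal_ne_zero.2 (sin_sub_ne_zero_of_mem hs hη.1 ?_)
    rintro rfl
    have := hη.2
    simp at this
    linarith
  · exact fun η hη => ⟨Ioo_subset_Icc_self hη.1, hη.2.le⟩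

lemma setIntegral_truncatedDomain {s ε : ℝ} (hε : 0 < ε) (h0 : ε < s)
    (h1 : ε < π - s) {f : ℝ → ℂ} (hf : IntegrableOn f (truncatedDomain s ε)) :
    ∫ η in truncatedDomain s ε, f η
      = (∫ η in (0 : ℝ)..(s - ε), f η) + ∫ η in (s + ε)..π, f η := by
  have hset : truncatedDomain s ε = Ioo 0 (s - ε) ∪ Ioo (s + ε) π := by
    ext η
    simp only [truncatedDomain, mem_ofPred_eq, mem_union, mem_Ioo, lt_abs]
    constructor
    · rintro ⟨⟨h2, h3⟩, h | h⟩
      · right; constructor <;> linarith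
      · left; constructor <;> linarith
    · rintro (⟨h2, h3⟩ | ⟨h2, h3⟩)
      · exact ⟨⟨h2, by linarith⟩, Or.inr (by linarith)⟩
      · exact ⟨⟨by linarith, h3⟩, Or.inl (by linarith)⟩
  rw [hset] at hf ⊢
  rw [setIntegral_union _ measurableSet_Ioo (hf.mono_set subset_union_left)
      (hf.mono_set subset_union_right), integral_of_le (by linarith), integral_of_le (by linarith),
    integral_Ioc_eq_integral_Ioo, integral_Ioc_eq_integral_Ioo]
  refine Set.disjoint_left.2 fun x hx hx' => ?_
  linarith [hx.2, hx'.1]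

lemma eventually_truncation_small {s : ℝ} (hs : s ∈ Ioo 0 π) :
    ∀ᶠ ε : ℝ in nhdsWithin 0 (Ioi 0), 0 < ε ∧ ε < s ∧ ε < π - s := by
  filter_upwards [Ioo_mem_nhdsGT (lt_min hs.1 (sub_pos.2 hs.2))] with ε hε
  exact ⟨hε.1, lt_min_iff.1 hε.2⟩

lemma tendsto_setIntegral_truncatedDomain {s : ℝ} (hs : s ∈ Ioo 0 π) {f : ℝ → ℂ}
    (hf : Continuous f) :
    Tendsto (fun ε => ∫ η in truncatedDomain s ε, f η) (nhdsWithin 0 (Ioi 0))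
      (nhds (∫ η in (0 : ℝ)..π, f η)) := by
  have hint : ∀ a b, IntervalIntegrable f volume a b := fun a b => hf.intervalIntegrable a b
  have hprim : Continuous fun x => ∫ η in (0 : ℝ)..x, f η := continuous_primitive hint 0
  have hlim : Tendsto (fun ε : ℝ => (∫ η in (0 : ℝ)..(s - ε), f η)
      + ((∫ η in (0 : ℝ)..π, f η) - ∫ η in (0 : ℝ)..(s + ε), f η)) (nhdsWithin 0 (Ioi 0))
      (nhds (∫ η in (0 : ℝ)..π, f η)) := by
    have hc : Continuous (fun ε : ℝ => (∫ η in (0 : ℝ)..(s - ε), f η)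
      + ((∫ η in (0 : ℝ)..π, f η) - ∫ η in (0 : ℝ)..(s + ε), f η)) :=
      (hprim.comp (continuous_const.sub continuous_id)).add
        (continuous_const.sub (hprim.comp (continuous_const.add continuous_id)))
    have := (hc.tendsto 0).mono_left (nhdsWithin_le_nhds (s := Ioi 0))
    simpa using this
  refine hlim.congr' ?_
  filter_upwards [eventually_truncation_small hs] with ε ⟨h0, h1, h2⟩
  rw [setIntegral_truncatedDomain h0 h1 h2, integral_interval_sub_left (hint _ _) (hint _ _)]
  exact (hf.integrableOn_Icc (a := 0) (b := π)).mono_set fun η hη => Ioo_subset_Icc_self hη.1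

lemma hasDerivAt_log_tan_half {s : ℝ} (hs : s ∈ Ioo 0 π) :
    HasDerivAt (fun x => Real.log (Real.tan (x / 2))) (1 / Real.sin s) s := by
  have h1 : 0 < Real.sin (s / 2) :=
    Real.sin_pos_of_pos_of_lt_pi (by linarith [hs.1]) (by linarith [hs.1, hs.2])
  have h2 : 0 < Real.cos (s / 2) :=
    Real.cos_pos_of_mem_Ioo ⟨by linarith [hs.1, Real.pi_pos], by linarith [hs.2]⟩
  have h3 : Real.sin s = 2 * Real.sin (s / 2) * Real.cos (s / 2) := by
    rw [← Real.sin_two_mul]; ring_nf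
  have ht : Real.tan (s / 2) ≠ 0 := by
    rw [Real.tan_eq_sin_div_cos]; positivity
  have hd : HasDerivAt (fun x => Real.tan (x / 2)) (1 / Real.cos (s / 2) ^ 2 * (1 / 2)) s :=
    HasDerivAt.comp s (h₂ := Real.tan) (h := fun x => x / 2) (Real.hasDerivAt_tan h2.ne')
      ((hasDerivAt_id s).div_const 2)
  convert hd.log ht using 1
  rw [h3, Real.tan_eq_sin_div_cos]
  field_simp

lemma integral_inv_sin {a b : ℝ} (ha : a ∈ Ioo 0 π) (hb : b ∈ Ioo 0 π) :
    ∫ u in a..b, 1 / Real.sin u = Real.log (Real.tan (b / 2)) - Real.log (Real.tan (a / 2)) := by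
  have hsub : uIcc a b ⊆ Ioo 0 π := ordConnected_Ioo.uIcc_subset ha hb
  refine integral_eq_sub_of_hasDerivAt (fun x hx => hasDerivAt_log_tan_half (hsub hx)) ?_
  refine ContinuousOn.intervalIntegrable (continuousOn_const.div (by fun_prop) fun x hx => ?_)
  exact (Real.sin_pos_of_mem_Ioo (hsub hx)).ne'

lemma log_tan_half_pi_sub (s : ℝ) :
    Real.log (Real.tan ((π - s) / 2)) = -Real.log (Real.tan (s / 2)) := by
  rw [show (π - s) / 2 = π / 2 - s / 2 by ring, Real.tan_pi_div_two_sub, Real.log_inv]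

lemma tendsto_truncated_inv_sin {s : ℝ} (hs : s ∈ Ioo 0 π) :
    Tendsto (fun ε => ∫ η in truncatedDomain s ε, 1 / (Real.sin (s - η) : ℂ))
      (nhdsWithin 0 (Ioi 0)) (nhds ((2 * Real.log (Real.tan (s / 2)) : ℝ) : ℂ)) := by
  refine tendsto_const_nhds.congr' ?_
  filter_upwards [eventually_truncation_small hs] with ε ⟨h0, h1, h2⟩
  rw [setIntegral_truncatedDomain h0 h1 h2 (integrableOn_div_sin_sub hs h0 continuous_const)]
  have hcast : ∀ η : ℝ, 1 / (Real.sin (s - η) : ℂ) = ((1 / Real.sin (s - η) : ℝ) : ℂ) := by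
    intro η; push_cast; rfl
  simp only [hcast]
  rw [intervalIntegral.integral_ofReal, intervalIntegral.integral_ofReal, ← Complex.ofReal_add]
  congr 1
  have e1 : ∫ η in (0 : ℝ)..(s - ε), 1 / Real.sin (s - η) = ∫ u in ε..s, 1 / Real.sin u := by
    have := intervalIntegral.integral_comp_sub_left (a := 0) (b := s - ε)
      (fun u => 1 / Real.sin u) s
    simpa using this
  have e2 : ∫ η in (s + ε)..π, 1 / Real.sin (s - η)
      = -∫ u in ε..(π - s), 1 / Real.sin u := by
    have := intervalIntegral.integral_comp_sub_right (a := s + ε) (b := π)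
      (fun u => 1 / Real.sin u) s
    rw [add_sub_cancel_left] at this
    rw [← this, ← intervalIntegral.integral_neg]
    refine intervalIntegral.integral_congr fun η _ => ?_
    rw [← neg_sub η s, Real.sin_neg, div_neg]
  have hπ := Real.pi_pos
  rw [e1, e2, integral_inv_sin ⟨h0, by linarith⟩ hs,
    integral_inv_sin ⟨h0, by linarith⟩ ⟨by linarith, by linarith [hs.1]⟩, log_tan_half_pi_sub]
  ring

lemma integral_exp_int_mul_of_odd {m : ℤ} (hm : Odd m) :
    ∫ s in (0 : ℝ)..π, Complex.exp (Complex.I * (m : ℂ) * (s : ℂ)) = 2 * Complex.I / (m : ℂ) := by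
  have hm0 : (m : ℂ) ≠ 0 := by
    rintro h
    have : m = 0 := by exact_mod_cast h
    subst this
    simp at hm
  rw [integral_exp_mul_complex (mul_ne_zero Complex.I_ne_zero hm0),
    show Complex.I * (m : ℂ) * (π : ℂ) = (m : ℂ) * (π * Complex.I) by ring, Complex.exp_int_mul,
    Complex.exp_pi_mul_I, hm.neg_one_zpow]
  simp
  field_simp
  simp
  norm_num

lemma integral_exp_int_mul_of_even {m : ℤ} (hm : Even m) :
    ∫ s in (0 : ℝ)..π, Complex.exp (Complex.I * (m : ℂ) * (s : ℂ))
      = if m = 0 then (π : ℂ) else 0 := by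
  split_ifs with h
  · simp [h]
  have hm0 : (m : ℂ) ≠ 0 := by exact_mod_cast h
  rw [integral_exp_mul_complex (mul_ne_zero Complex.I_ne_zero hm0),
    show Complex.I * (m : ℂ) * (π : ℂ) = (m : ℂ) * (π * Complex.I) by ring, Complex.exp_int_mul,
    Complex.exp_pi_mul_I, hm.neg_one_zpow]
  simp

lemma integral_sin_mul_exp_int_mul (m : ℤ) :
    ∫ s in (0 : ℝ)..π, (Real.sin s : ℂ) * Complex.exp (Complex.I * (m : ℂ) * (s : ℂ))
      = ((∫ s in (0 : ℝ)..π, Complex.exp (Complex.I * ((m + 1 : ℤ) : ℂ) * (s : ℂ)))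
        - ∫ s in (0 : ℝ)..π, Complex.exp (Complex.I * ((m - 1 : ℤ) : ℂ) * (s : ℂ)))
        / (2 * Complex.I) := by
  rw [← intervalIntegral.integral_sub, ← intervalIntegral.integral_div]
  · refine intervalIntegral.integral_congr fun s _ => ?_
    simp only [Complex.ofReal_sin, Complex.sin]
    push_cast
    rw [show Complex.I * ((m : ℂ) + 1) * s = Complex.I * m * s + s * Complex.I by ring,
      show Complex.I * ((m : ℂ) - 1) * s = Complex.I * m * s + -s * Complex.I by ring,
      Complex.exp_add, Complex.exp_add]
    field_simp
    simp
  all_goals exact Continuous.intervalIntegrable (by fun_prop) _ _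

lemma integral_sin_mul_exp_int_mul_of_even {m : ℤ} (hm : Even m) :
    ∫ s in (0 : ℝ)..π, (Real.sin s : ℂ) * Complex.exp (Complex.I * (m : ℂ) * (s : ℂ))
      = 2 / (1 - (m : ℂ) ^ 2) := by
  have h1 : ((m + 1 : ℤ) : ℂ) ≠ 0 := by
    have : m + 1 ≠ 0 := by rintro h; have := hm.add_one; rw [h] at this; simp at this
    exact_mod_cast this
  have h2 : ((m - 1 : ℤ) : ℂ) ≠ 0 := by
    have : m - 1 ≠ 0 := by rintro h; have := hm.sub_odd odd_one; rw [h] at this; simp at this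
    exact_mod_cast this
  rw [integral_sin_mul_exp_int_mul, integral_exp_int_mul_of_odd hm.add_one,
    integral_exp_int_mul_of_odd (hm.sub_odd odd_one)]
  push_cast at h1 h2 ⊢
  have h3 : 1 - (m : ℂ) ^ 2 ≠ 0 := by
    rw [show 1 - (m : ℂ) ^ 2 = -((m + 1) * (m - 1)) by ring]
    exact neg_ne_zero.2 (mul_ne_zero h1 h2)
  field_simp
  ring

lemma integral_sin_mul_exp_int_mul_of_odd {m : ℤ} (hm : Odd m) :
    ∫ s in (0 : ℝ)..π, (Real.sin s : ℂ) * Complex.exp (Complex.I * (m : ℂ) * (s : ℂ))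
      = if m = 1 then Complex.I * π / 2 else if m = -1 then -(Complex.I * π / 2) else 0 := by
  rw [integral_sin_mul_exp_int_mul, integral_exp_int_mul_of_even hm.add_one,
    integral_exp_int_mul_of_even (hm.sub_odd odd_one)]
  rcases eq_or_ne m 1 with rfl | h1
  · norm_num
    field_simp
    simp
  rcases eq_or_ne m (-1) with rfl | h2
  · norm_num
    field_simp
    simp
  rw [if_neg (by omega), if_neg (by omega), if_neg h1, if_neg h2]
  simp

lemma exp_two_mul_eq (s η : ℝ) :
    Complex.exp (2 * Complex.I * η) = Complex.exp (2 * Complex.I * s)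
      - 2 * Complex.I * Complex.exp (Complex.I * s) * Complex.exp (Complex.I * η)
        * (Real.sin (s - η) : ℂ) := by
  have h : ∀ z : ℂ, Complex.exp (2 * Complex.I * z) = Complex.exp (Complex.I * z) ^ 2 := by
    intro z; rw [← Complex.exp_nat_mul]; ring_nf
  have hs := Complex.exp_ne_zero (Complex.I * s)
  have hη := Complex.exp_ne_zero (Complex.I * η)
  rw [h, h, Complex.ofReal_sin, Complex.sin, Complex.ofReal_sub,
    show -((s : ℂ) - η) * Complex.I = Complex.I * η - Complex.I * s by ring,
    show ((s : ℂ) - η) * Complex.I = Complex.I * s - Complex.I * η by ring,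
    Complex.exp_sub, Complex.exp_sub]
  field_simp
  simp

/-- `G` is the principal value on `(0, π)` of `sin η * exp (i k η)` against `1 / sin (s - η)`. -/
def IsPrincipalValue (k : ℤ) (G : ℝ → ℂ) : Prop :=
  ∀ s ∈ Ioo 0 π, Tendsto (fun ε : ℝ => ∫ η in truncatedDomain s ε,
      (Real.sin η : ℂ) * Complex.exp (Complex.I * (k : ℂ) * (η : ℂ)) / (Real.sin (s - η) : ℂ))
    (nhdsWithin 0 (Ioi 0)) (nhds (G s))

lemma truncated_integral_add_two (k : ℤ) {s ε : ℝ} (hs : s ∈ Ioo 0 π) (hε : 0 < ε) :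
    ∫ η in truncatedDomain s ε, (Real.sin η : ℂ)
        * Complex.exp (Complex.I * ((k + 2 : ℤ) : ℂ) * (η : ℂ)) / (Real.sin (s - η) : ℂ)
      = Complex.exp (2 * Complex.I * s) * (∫ η in truncatedDomain s ε, (Real.sin η : ℂ)
        * Complex.exp (Complex.I * (k : ℂ) * (η : ℂ)) / (Real.sin (s - η) : ℂ))
      + -2 * Complex.I * Complex.exp (Complex.I * s) * ∫ η in truncatedDomain s ε,
        (Real.sin η : ℂ) * Complex.exp (Complex.I * ((k + 1 : ℤ) : ℂ) * (η : ℂ)) := by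
  rw [← MeasureTheory.integral_const_mul, ← MeasureTheory.integral_const_mul,
    ← MeasureTheory.integral_add]
  · refine setIntegral_congr_fun (measurableSet_truncatedDomain s ε) fun η hη => ?_
    have hne : (Real.sin (s - η) : ℂ) ≠ 0 := Complex.ofReal_ne_zero.2
      (sin_sub_ne_zero_of_mem hs (Ioo_subset_Icc_self hη.1) (ne_of_mem_truncatedDomain hε hη))
    push_cast [-Complex.ofReal_sin, -Complex.ofReal_sub]
    rw [show Complex.I * ((k : ℂ) + 2) * η = Complex.I * k * η + 2 * Complex.I * η by ring,
      show Complex.I * ((k : ℂ) + 1) * η = Complex.I * k * η + Complex.I * η by ring,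
      Complex.exp_add, Complex.exp_add, exp_two_mul_eq s η]
    generalize (Real.sin (s - η) : ℂ) = z at hne
    field_simp
    ring
  · exact (integrableOn_div_sin_sub hs hε (by fun_prop)).const_mul _
  · refine Integrable.const_mul ?_ _
    exact (Continuous.integrableOn_Icc (a := 0) (b := π) (by fun_prop)).mono_set
      fun η hη => Ioo_subset_Icc_self hη.1

lemma isPrincipalValue_add_two_iff {k : ℤ} (hk : Odd k) {G H : ℝ → ℂ}
    (hGH : ∀ s, H s = Complex.exp (2 * Complex.I * s) * G s
      + -2 * Complex.I * Complex.exp (Complex.I * s) * (2 / (1 - ((k + 1 : ℤ) : ℂ) ^ 2))) :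
    IsPrincipalValue (k + 2) H ↔ IsPrincipalValue k G := by
  refine forall₂_congr fun s hs => ?_
  have hreg := ((tendsto_setIntegral_truncatedDomain hs (f := fun η =>
    (Real.sin η : ℂ) * Complex.exp (Complex.I * ((k + 1 : ℤ) : ℂ) * (η : ℂ)))
    (by fun_prop)).const_mul (-2 * Complex.I * Complex.exp (Complex.I * s)))
  rw [integral_sin_mul_exp_int_mul_of_even hk.add_one] at hreg
  have hev : ∀ᶠ ε : ℝ in nhdsWithin 0 (Ioi 0), 0 < ε := self_mem_nhdsWithin
  have hexp := Complex.exp_ne_zero (2 * Complex.I * s)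
  rw [hGH]
  constructor
  · intro h
    have h2 := (h.sub hreg).const_mul (Complex.exp (2 * Complex.I * s))⁻¹
    rw [add_sub_cancel_right, inv_mul_cancel_left₀ hexp] at h2
    refine h2.congr' ?_
    filter_upwards [hev] with ε hε
    rw [truncated_integral_add_two k hs hε, add_sub_cancel_right, inv_mul_cancel_left₀ hexp]
  · intro h
    refine ((h.const_mul (Complex.exp (2 * Complex.I * s))).add hreg).congr' ?_
    filter_upwards [hev] with ε hε
    exact (truncated_integral_add_two k hs hε).symm

/-- The continuous extension of `sin s * log (tan (s / 2))`. -/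
noncomputable def sinMulLogTan (s : ℝ) : ℝ := Real.sin s * Real.log (Real.tan (s / 2))

lemma continuous_sinMulLogTan : Continuous sinMulLogTan := by
  have h : sinMulLogTan = fun s =>
      2 * Real.cos (s / 2) * (Real.sin (s / 2) * Real.log (Real.sin (s / 2)))
        - 2 * Real.sin (s / 2) * (Real.cos (s / 2) * Real.log (Real.cos (s / 2))) := by
    ext s
    have hlog : Real.log (Real.tan (s / 2))
        = Real.log (Real.sin (s / 2)) - Real.log (Real.cos (s / 2)) := by
      rw [Real.tan_eq_sin_div_cos]
      rcases eq_or_ne (Real.sin (s / 2)) 0 with h0 | h0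
      · rcases Real.sin_eq_zero_iff_cos_eq.1 h0 with h | h <;> simp [h0, h]
      rcases eq_or_ne (Real.cos (s / 2)) 0 with h1 | h1
      · rcases Real.cos_eq_zero_iff_sin_eq.1 h1 with h | h <;> simp [h1, h]
      exact Real.log_div h0 h1
    have hsin : Real.sin s = 2 * Real.sin (s / 2) * Real.cos (s / 2) := by
      rw [← Real.sin_two_mul]; ring_nf
    rw [sinMulLogTan, hlog, hsin]
    ring
  have h1 : Continuous fun s : ℝ => Real.sin (s / 2) * Real.log (Real.sin (s / 2)) :=
    Real.continuous_mul_log.comp (by fun_prop : Continuous fun s : ℝ => Real.sin (s / 2))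
  have h2 : Continuous fun s : ℝ => Real.cos (s / 2) * Real.log (Real.cos (s / 2)) :=
    Real.continuous_mul_log.comp (by fun_prop : Continuous fun s : ℝ => Real.cos (s / 2))
  rw [h]
  fun_prop

lemma sinMulLogTan_pi_sub (s : ℝ) : sinMulLogTan (π - s) = -sinMulLogTan s := by
  rw [sinMulLogTan, sinMulLogTan, Real.sin_pi_sub, log_tan_half_pi_sub, mul_neg]

lemma isPrincipalValue_one : IsPrincipalValue 1 fun s =>
    Complex.exp (Complex.I * s) * (2 * (sinMulLogTan s : ℂ) - 2 * Complex.I) := by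
  intro s hs
  have h1 := (tendsto_truncated_inv_sin hs).const_mul
    ((Real.sin s : ℂ) * Complex.exp (Complex.I * s))
  have h2 := (tendsto_setIntegral_truncatedDomain hs (f := fun η =>
    Complex.exp (Complex.I * ((1 : ℤ) : ℂ) * (η : ℂ))) (by fun_prop)).const_mul
      (Complex.exp (Complex.I * s))
  rw [integral_exp_int_mul_of_odd odd_one] at h2
  have h3 := h1.sub h2
  refine Tendsto.congr' ?_ (h3.trans_eq ?_)
  · filter_upwards [self_mem_nhdsWithin] with ε hε
    have hε : 0 < ε := hε
    rw [← MeasureTheory.integral_const_mul, ← MeasureTheory.integral_const_mul,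
      ← MeasureTheory.integral_sub]
    · refine setIntegral_congr_fun (measurableSet_truncatedDomain s ε) fun η hη => ?_
      have hne : (Real.sin (s - η) : ℂ) ≠ 0 := Complex.ofReal_ne_zero.2
        (sin_sub_ne_zero_of_mem hs (Ioo_subset_Icc_self hη.1) (ne_of_mem_truncatedDomain hε hη))
      have hsin : ∀ x : ℝ, (Real.sin x : ℂ) * Complex.exp (Complex.I * x)
          = (Complex.exp (2 * Complex.I * x) - 1) / (2 * Complex.I) := by
        intro x
        rw [Complex.ofReal_sin, Complex.sin, mul_comm (x : ℂ) Complex.I,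
          show -(x : ℂ) * Complex.I = -(Complex.I * x) by ring, Complex.exp_neg,
          show 2 * Complex.I * (x : ℂ) = Complex.I * x + Complex.I * x by ring, Complex.exp_add]
        have := Complex.exp_ne_zero (Complex.I * x)
        field_simp
        simp
      simp only [Int.cast_one, mul_one]
      rw [hsin, hsin, exp_two_mul_eq s η]
      generalize (Real.sin (s - η) : ℂ) = z at hne
      field_simp
      ring
    · exact (integrableOn_div_sin_sub hs hε continuous_const).const_mul _
    · refine Integrable.const_mul ?_ _
      exact (Continuous.integrableOn_Icc (a := 0) (b := π) (by fun_prop)).mono_set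
        fun η hη => Ioo_subset_Icc_self hη.1
  · congr 1
    simp only [sinMulLogTan]
    push_cast
    ring

lemma integral_eval_chebyshev_U_even (j : ℤ) :
    ∫ s in (0 : ℝ)..π, (Polynomial.Chebyshev.U ℝ (2 * j)).eval (Real.cos s)
      = if 0 ≤ j then π else -π := by
  have hstep : ∀ j : ℤ,
      ∫ s in (0 : ℝ)..π, (Polynomial.Chebyshev.U ℝ (2 * (j + 1))).eval (Real.cos s)
      = (∫ s in (0 : ℝ)..π, (Polynomial.Chebyshev.U ℝ (2 * j)).eval (Real.cos s))
        + if j = -1 then 2 * π else 0 := by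
    intro j
    have hcos : ∫ s in (0 : ℝ)..π, 2 * Real.cos ((2 * (j + 1) : ℤ) * s)
        = if j = -1 then 2 * π else 0 := by
      split_ifs with h
      · subst h; simp; ring
      have h0 : ((2 * (j + 1) : ℤ) : ℝ) ≠ 0 := by
        have : 2 * (j + 1) ≠ 0 := by omega
        exact_mod_cast this
      rw [intervalIntegral.integral_const_mul, intervalIntegral.integral_comp_mul_left _ h0]
      simp [-Int.cast_mul, Real.sin_int_mul_pi]
    rw [← hcos, ← intervalIntegral.integral_add]
    · refine intervalIntegral.integral_congr fun s _ => ?_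
      rw [← Polynomial.Chebyshev.T_real_cos, show 2 * (j + 1) = 2 * j + 2 by ring,
        Polynomial.Chebyshev.U_eq_two_mul_T_add_U]
      simp
      ring
    all_goals exact Continuous.intervalIntegrable (by fun_prop) _ _
  induction j using Int.induction_on with
  | zero => simp
  | succ i ih =>
    rw [hstep, ih, if_pos (Int.natCast_nonneg i), if_neg (show ¬((i : ℤ) = -1) by omega),
      if_pos (show (0 : ℤ) ≤ i + 1 by omega), add_zero]
  | pred i ih =>
    have h := hstep (-(i : ℤ) - 1)
    rw [sub_add_cancel, ih] at h
    rw [if_neg (by omega)]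
    rcases Nat.eq_zero_or_pos i with rfl | hi
    · simp
    · rw [if_neg (by omega), if_neg (by omega)] at h
      linarith

lemma integral_sin_mul_sinMulLogTan_mul_cos {n j : ℤ} (hn : n = 2 * j + 1) :
    ∫ s in (0 : ℝ)..π, 2 * Real.sin s * Real.cos (n * s) * sinMulLogTan s
      = -((if 0 ≤ j then π else -π) / n - (if 0 ≤ j + 1 then π else -π) / (2 * (n + 2))
        - (if 0 ≤ j - 1 then π else -π) / (2 * (n - 2))) := by
  set ψ : ℝ → ℝ := fun s => (Polynomial.Chebyshev.U ℝ (2 * j)).eval (Real.cos s) / n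
    - (Polynomial.Chebyshev.U ℝ (2 * (j + 1))).eval (Real.cos s) / (2 * (n + 2))
    - (Polynomial.Chebyshev.U ℝ (2 * (j - 1))).eval (Real.cos s) / (2 * (n - 2)) with hψ
  have hn0 : (n : ℝ) ≠ 0 := by exact_mod_cast (by omega : n ≠ 0)
  have hn1 : (n : ℝ) + 2 ≠ 0 := by exact_mod_cast (by omega : n + 2 ≠ 0)
  have hn2 : (n : ℝ) - 2 ≠ 0 := by exact_mod_cast (by omega : n - 2 ≠ 0)
  have hψc : Continuous ψ := by fun_prop
  have hψI : ∫ s in (0 : ℝ)..π, ψ s = (if 0 ≤ j then π else -π) / n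
      - (if 0 ≤ j + 1 then π else -π) / (2 * (n + 2))
      - (if 0 ≤ j - 1 then π else -π) / (2 * (n - 2)) := by
    rw [hψ, intervalIntegral.integral_sub, intervalIntegral.integral_sub,
      intervalIntegral.integral_div, intervalIntegral.integral_div, intervalIntegral.integral_div,
      integral_eval_chebyshev_U_even, integral_eval_chebyshev_U_even,
      integral_eval_chebyshev_U_even]
    all_goals exact Continuous.intervalIntegrable (by fun_prop) _ _
  have hΦ : ∀ s, ψ s * Real.sin s = Real.sin (n * s) / n
      - Real.sin ((n + 2) * s) / (2 * (n + 2)) - Real.sin ((n - 2) * s) / (2 * (n - 2)) := by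
    intro s
    have hU : ∀ i : ℤ, Real.sin ((2 * i + 1) * s)
        = (Polynomial.Chebyshev.U ℝ (2 * i)).eval (Real.cos s) * Real.sin s := by
      intro i
      rw [Polynomial.Chebyshev.U_real_cos]
      push_cast
      rfl
    have h0 := hU j
    have h1 := hU (j + 1)
    have h2 := hU (j - 1)
    have hnr : (n : ℝ) = 2 * j + 1 := by exact_mod_cast hn
    push_cast at h1 h2
    rw [show (2 * ((j : ℝ) + 1) + 1) = n + 2 by rw [hnr]; ring] at h1
    rw [show (2 * ((j : ℝ) - 1) + 1) = n - 2 by rw [hnr]; ring] at h2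
    rw [← hnr] at h0
    rw [h0, h1, h2, hψ]
    ring
  have hFTC : ∫ s in (0 : ℝ)..π, (2 * Real.sin s * Real.cos (n * s) * sinMulLogTan s + ψ s)
      = ψ π * sinMulLogTan π - ψ 0 * sinMulLogTan 0 := by
    refine integral_eq_sub_of_hasDerivAt_of_le Real.pi_pos.le
      (hψc.mul continuous_sinMulLogTan).continuousOn (fun s hs => ?_)
      (Continuous.intervalIntegrable ?_ _ _)
    · have hF : (fun s => ψ s * sinMulLogTan s) = fun s => (Real.sin (n * s) / n
          - Real.sin ((n + 2) * s) / (2 * (n + 2)) - Real.sin ((n - 2) * s) / (2 * (n - 2)))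
          * Real.log (Real.tan (s / 2)) := by
        ext s
        rw [← hΦ, sinMulLogTan]
        ring
      have hlin : ∀ c : ℝ, HasDerivAt (fun s => Real.sin (c * s)) (Real.cos (c * s) * c) s :=
        fun c => by simpa using ((hasDerivAt_id s).const_mul c).sin
      have hd := ((((hlin n).div_const n).sub ((hlin (n + 2)).div_const (2 * (n + 2)))).sub
        ((hlin (n - 2)).div_const (2 * (n - 2)))).mul (hasDerivAt_log_tan_half hs)
      change HasDerivAt (fun s => ψ s * sinMulLogTan s) _ s
      rw [hF]
      refine hd.congr_deriv ?_
      have hsin := (Real.sin_pos_of_mem_Ioo hs).ne'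
      simp only [Pi.sub_apply]
      have hcos : Real.cos (s * (n + 2)) + Real.cos (s * (n - 2))
          = 2 * Real.cos (n * s) * (1 - 2 * Real.sin s ^ 2) := by
        rw [mul_add, mul_sub, mul_comm s n, mul_comm s 2, Real.cos_add, Real.cos_sub,
          Real.cos_two_mul, Real.cos_sq']
        ring
      rw [← hΦ, sinMulLogTan]
      field_simp
      linear_combination (-Real.log (Real.tan (s / 2))) * hcos
    · have := continuous_sinMulLogTan
      fun_prop
  rw [intervalIntegral.integral_add, hψI] at hFTC
  · have h0 : sinMulLogTan 0 = 0 := by simp [sinMulLogTan]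
    have hp : sinMulLogTan π = 0 := by simp [sinMulLogTan]
    rw [h0, hp] at hFTC
    linarith
  · have := continuous_sinMulLogTan
    exact Continuous.intervalIntegrable (by fun_prop) _ _
  · exact hψc.intervalIntegrable _ _

lemma integral_sin_mul_sinMulLogTan_mul_exp {n : ℤ} (hn : Odd n) :
    2 * ∫ s in (0 : ℝ)..π, (Real.sin s : ℂ) * sinMulLogTan s
        * Complex.exp (Complex.I * (n : ℂ) * (s : ℂ))
      = ((∫ s in (0 : ℝ)..π, 2 * Real.sin s * Real.cos (n * s) * sinMulLogTan s : ℝ) : ℂ) := by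
  have hc := continuous_sinMulLogTan
  have hrefl := intervalIntegral.integral_comp_sub_left (a := 0) (b := π)
    (fun s : ℝ => (Real.sin s : ℂ) * sinMulLogTan s
      * Complex.exp (Complex.I * (n : ℂ) * (s : ℂ))) π
  simp only [sub_self, sub_zero] at hrefl
  rw [two_mul]
  nth_rewrite 1 [← hrefl]
  rw [← intervalIntegral.integral_add, ← intervalIntegral.integral_ofReal]
  · refine intervalIntegral.integral_congr fun s _ => ?_
    have hexp : Complex.exp (Complex.I * (n : ℂ) * ((π - s : ℝ) : ℂ))
        = -Complex.exp (-(n * s) * Complex.I) := by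
      rw [show Complex.I * (n : ℂ) * ((π - s : ℝ) : ℂ)
          = (n : ℂ) * (π * Complex.I) + -(n * s) * Complex.I by push_cast; ring, Complex.exp_add,
        Complex.exp_int_mul, Complex.exp_pi_mul_I, hn.neg_one_zpow]
      ring
    rw [hexp, Real.sin_pi_sub, sinMulLogTan_pi_sub]
    push_cast
    rw [show Complex.I * (n : ℂ) * s = n * s * Complex.I by ring]
    rw [Complex.cos]
    ring
  all_goals exact Continuous.intervalIntegrable (by fun_prop) _ _

/-- The Fourier coefficient of `sin s * G s` at frequency `2 * l` on `(0, π)`. -/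
noncomputable def sinFourierCoeff (G : ℝ → ℂ) (l : ℤ) : ℂ :=
  (1 / (π : ℂ)) * ∫ s in (0:ℝ)..π,
    (Real.sin s : ℂ) * G s * Complex.exp (-2 * Complex.I * (l : ℂ) * (s : ℂ))

/-- The closed form of the coefficients of the principal value. -/
noncomputable def halfLaplacianCoeff (k l : ℤ) : ℂ :=
  if l = 0 then -2 / ((k : ℂ) ^ 2 - 4)
  else -4 * (Int.sign l : ℂ) / (((k : ℂ) - 2 * (l : ℂ)) * (((k : ℂ) - 2 * (l : ℂ)) ^ 2 - 4))

lemma sinFourierCoeff_one (l : ℤ) :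
    sinFourierCoeff (fun s : ℝ =>
      Complex.exp (Complex.I * s) * (2 * (sinMulLogTan s : ℂ) - 2 * Complex.I)) l
      = halfLaplacianCoeff 1 l := by
  have hc := continuous_sinMulLogTan
  have hn : Odd (1 - 2 * l) := ⟨-l, by ring⟩
  have hsplit : ∫ s in (0:ℝ)..π, (Real.sin s : ℂ) * (Complex.exp (Complex.I * s)
        * (2 * (sinMulLogTan s : ℂ) - 2 * Complex.I))
        * Complex.exp (-2 * Complex.I * (l : ℂ) * (s : ℂ))
      = 2 * (∫ s in (0 : ℝ)..π, (Real.sin s : ℂ) * sinMulLogTan s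
        * Complex.exp (Complex.I * ((1 - 2 * l : ℤ) : ℂ) * (s : ℂ)))
      - 2 * Complex.I * ∫ s in (0 : ℝ)..π, (Real.sin s : ℂ)
        * Complex.exp (Complex.I * ((1 - 2 * l : ℤ) : ℂ) * (s : ℂ)) := by
    rw [← intervalIntegral.integral_const_mul, ← intervalIntegral.integral_const_mul,
      ← intervalIntegral.integral_sub]
    · refine intervalIntegral.integral_congr fun s _ => ?_
      rw [show Complex.I * ((1 - 2 * l : ℤ) : ℂ) * (s : ℂ)
        = Complex.I * s + -2 * Complex.I * l * s by push_cast; ring, Complex.exp_add]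
      ring
    all_goals exact Continuous.intervalIntegrable (by fun_prop) _ _
  have hπ : (π : ℂ) ≠ 0 := Complex.ofReal_ne_zero.2 Real.pi_ne_zero
  rw [sinFourierCoeff, hsplit, integral_sin_mul_sinMulLogTan_mul_exp hn,
    integral_sin_mul_sinMulLogTan_mul_cos (j := -l) (by ring),
    integral_sin_mul_exp_int_mul_of_odd hn, halfLaplacianCoeff]
  have hI : Complex.I ^ 2 = -1 := Complex.I_sq
  rcases eq_or_ne l 0 with rfl | h0
  · norm_num
    field_simp
    rw [hI]
    norm_num
  rcases eq_or_ne l 1 with rfl | h1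
  · norm_num
    field_simp
    rw [hI]
    norm_num
  have e0 : (1 - 2 * l : ℂ) ≠ 0 := by exact_mod_cast (by omega : 1 - 2 * l ≠ 0)
  have e1 : (1 - 2 * l + 2 : ℂ) ≠ 0 := by exact_mod_cast (by omega : 1 - 2 * l + 2 ≠ 0)
  have e2 : (1 - 2 * l - 2 : ℂ) ≠ 0 := by exact_mod_cast (by omega : 1 - 2 * l - 2 ≠ 0)
  have e3 : (1 - 2 * l : ℂ) ^ 2 - 4 ≠ 0 := by
    rw [show (1 - 2 * l : ℂ) ^ 2 - 4 = (1 - 2 * l + 2) * (1 - 2 * l - 2) by ring]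
    exact mul_ne_zero e1 e2
  rw [if_neg h0, if_neg (show ¬(1 - 2 * l = 1) by omega),
    if_neg (show ¬(1 - 2 * l = -1) by omega)]
  rcases lt_or_gt_of_ne h0 with hl | hl
  · rw [if_pos (by omega), if_pos (by omega), if_pos (by omega), Int.sign_eq_neg_one_of_neg hl]
    push_cast
    field_simp
    ring
  · rw [if_neg (by omega), if_neg (by omega), if_neg (by omega), Int.sign_eq_one_of_pos hl]
    push_cast
    field_simp
    ring

lemma halfLaplacianCoeff_add_two {k : ℤ} (hk : Odd k) (l : ℤ) :
    halfLaplacianCoeff (k + 2) (l + 1) = halfLaplacianCoeff k l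
      + (if l = 0 then 2 / ((k : ℂ) * (k + 2)) else if l = -1 then -2 / ((k : ℂ) * (k + 2))
        else 0) := by
  obtain ⟨m, hm⟩ := hk
  have e0 : (k : ℂ) ≠ 0 := by exact_mod_cast (by omega : k ≠ 0)
  have e1 : (k : ℂ) + 2 ≠ 0 := by exact_mod_cast (by omega : k + 2 ≠ 0)
  have e2 : (k : ℂ) - 2 ≠ 0 := by exact_mod_cast (by omega : k - 2 ≠ 0)
  have e3 : (k : ℂ) + 4 ≠ 0 := by exact_mod_cast (by omega : k + 4 ≠ 0)
  have e4 : (k : ℂ) ^ 2 - 4 ≠ 0 := by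
    rw [show (k : ℂ) ^ 2 - 4 = (k + 2) * (k - 2) by ring]
    exact mul_ne_zero e1 e2
  have e5 : ((k : ℂ) + 2) ^ 2 - 4 ≠ 0 := by
    rw [show ((k : ℂ) + 2) ^ 2 - 4 = k * (k + 4) by ring]
    exact mul_ne_zero e0 e3
  rw [halfLaplacianCoeff, halfLaplacianCoeff]
  rcases eq_or_ne l 0 with rfl | h0
  · norm_num
    field_simp
    ring
  rcases eq_or_ne l (-1) with rfl | h1
  · norm_num
    field_simp
    ring
  have hs : (l + 1).sign = l.sign := by
    rcases lt_or_gt_of_ne h0 with hl | hl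
    · rw [Int.sign_eq_neg_one_of_neg hl, Int.sign_eq_neg_one_of_neg (by omega)]
    · rw [Int.sign_eq_one_of_pos hl, Int.sign_eq_one_of_pos (by omega)]
  rw [if_neg (by omega), if_neg h0, if_neg h0, if_neg h1, hs, add_zero]
  push_cast
  rw [show (k : ℂ) + 2 - 2 * (l + 1) = k - 2 * l by ring]

lemma sinFourierCoeff_add_two {k : ℤ} (hk : Odd k) {G H : ℝ → ℂ} (hG : Continuous G)
    (hGH : ∀ s, H s = Complex.exp (2 * Complex.I * s) * G s
      + -2 * Complex.I * Complex.exp (Complex.I * s) * (2 / (1 - ((k + 1 : ℤ) : ℂ) ^ 2))) (l : ℤ) :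
    sinFourierCoeff H (l + 1) = sinFourierCoeff G l
      + (if l = 0 then 2 / ((k : ℂ) * (k + 2)) else if l = -1 then -2 / ((k : ℂ) * (k + 2))
        else 0) := by
  have hsplit : ∫ s in (0:ℝ)..π, (Real.sin s : ℂ) * H s
        * Complex.exp (-2 * Complex.I * ((l + 1 : ℤ) : ℂ) * (s : ℂ))
      = (∫ s in (0:ℝ)..π, (Real.sin s : ℂ) * G s
        * Complex.exp (-2 * Complex.I * (l : ℂ) * (s : ℂ)))
      + (-2 * Complex.I * (2 / (1 - ((k + 1 : ℤ) : ℂ) ^ 2))) * ∫ s in (0 : ℝ)..π, (Real.sin s : ℂ)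
        * Complex.exp (Complex.I * ((-(2 * l + 1) : ℤ) : ℂ) * (s : ℂ)) := by
    rw [← intervalIntegral.integral_const_mul, ← intervalIntegral.integral_add]
    · refine intervalIntegral.integral_congr fun s _ => ?_
      simp only [hGH]
      rw [show Complex.I * ((-(2 * l + 1) : ℤ) : ℂ) * (s : ℂ)
          = Complex.I * s + -2 * Complex.I * ((l + 1 : ℤ) : ℂ) * s by push_cast; ring,
        show -2 * Complex.I * (l : ℂ) * s
          = 2 * Complex.I * s + -2 * Complex.I * ((l + 1 : ℤ) : ℂ) * s by push_cast; ring,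
        Complex.exp_add, Complex.exp_add]
      ring
    all_goals exact Continuous.intervalIntegrable (by fun_prop) _ _
  have hπ : (π : ℂ) ≠ 0 := Complex.ofReal_ne_zero.2 Real.pi_ne_zero
  have hI : Complex.I ^ 2 = -1 := Complex.I_sq
  rw [sinFourierCoeff, sinFourierCoeff, hsplit,
    integral_sin_mul_exp_int_mul_of_odd (show Odd (-(2 * l + 1)) from ⟨-l - 1, by ring⟩), mul_add]
  congr 1
  obtain ⟨m, hm⟩ := hk
  have e0 : (k : ℂ) ≠ 0 := by exact_mod_cast (by omega : k ≠ 0)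
  have e1 : (k : ℂ) + 2 ≠ 0 := by exact_mod_cast (by omega : k + 2 ≠ 0)
  rw [show 1 - ((k + 1 : ℤ) : ℂ) ^ 2 = -(k * (k + 2)) by push_cast; ring]
  rcases eq_or_ne l 0 with rfl | h0
  · norm_num
    field_simp
    rw [hI]
    norm_num
  rcases eq_or_ne l (-1) with rfl | h1
  · norm_num
    field_simp
    rw [hI]
  rw [if_neg (by omega), if_neg (by omega), if_neg h0, if_neg h1]
  ring

lemma exists_isPrincipalValue_sinFourierCoeff {k : ℤ} (hk : Odd k) :
    ∃ G : ℝ → ℂ, Continuous G ∧ IsPrincipalValue k G ∧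
      ∀ l, sinFourierCoeff G l = halfLaplacianCoeff k l := by
  obtain ⟨m, rfl⟩ := hk
  induction m using Int.induction_on with
  | zero =>
    refine ⟨_, ?_, isPrincipalValue_one, sinFourierCoeff_one⟩
    have := continuous_sinMulLogTan
    fun_prop
  | succ i ih =>
    obtain ⟨G, hc, hG, hl⟩ := ih
    have hodd : Odd (2 * (i : ℤ) + 1) := ⟨i, rfl⟩
    rw [show 2 * ((i : ℤ) + 1) + 1 = 2 * (i : ℤ) + 1 + 2 by ring]
    refine ⟨_, ?_, (isPrincipalValue_add_two_iff hodd fun s => rfl).2 hG, fun l => ?_⟩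
    · fun_prop
    · have h := sinFourierCoeff_add_two hodd hc (fun s => rfl) (l - 1)
      rw [hl, ← halfLaplacianCoeff_add_two hodd, sub_add_cancel] at h
      exact h
  | pred i ih =>
    obtain ⟨H, hc, hH, hl⟩ := ih
    have hodd : Odd (2 * (-(i : ℤ) - 1) + 1) := ⟨-(i : ℤ) - 1, rfl⟩
    rw [show 2 * (-(i : ℤ)) + 1 = 2 * (-(i : ℤ) - 1) + 1 + 2 by ring] at hH hl
    generalize 2 * (-(i : ℤ) - 1) + 1 = k at *
    have hGH : ∀ s : ℝ, H s = Complex.exp (2 * Complex.I * s) * (Complex.exp (-(2 * Complex.I * s))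
        * (H s - -2 * Complex.I * Complex.exp (Complex.I * s)
          * (2 / (1 - ((k + 1 : ℤ) : ℂ) ^ 2))))
        + -2 * Complex.I * Complex.exp (Complex.I * s)
          * (2 / (1 - ((k + 1 : ℤ) : ℂ) ^ 2)) := by
      intro s
      rw [← mul_assoc, ← Complex.exp_add, add_neg_cancel, Complex.exp_zero]
      ring
    have hGc : Continuous fun s : ℝ => Complex.exp (-(2 * Complex.I * s))
        * (H s - -2 * Complex.I * Complex.exp (Complex.I * s)
          * (2 / (1 - ((k + 1 : ℤ) : ℂ) ^ 2))) := by fun_prop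
    refine ⟨_, hGc, (isPrincipalValue_add_two_iff hodd hGH).1 hH, fun l => ?_⟩
    have h := sinFourierCoeff_add_two hodd hGc hGH l
    rw [hl, halfLaplacianCoeff_add_two hodd] at h
    exact (add_right_cancel h).symm



/-- Fourier coefficients for the half-Laplacian applied to e^{iks}, k odd. -/
theorem stmt_7 (k : ℤ) (hk : Odd k) :
    ∃ G : ℝ → ℂ,
      (∀ s ∈ Set.Ioo 0 π,
        Tendsto (fun ε : ℝ => ∫ η in {η : ℝ | η ∈ Set.Ioo 0 π ∧ ε < |η - s|},
            (Real.sin η : ℂ) * Complex.exp (Complex.I * (k : ℂ) * (η : ℂ))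
              / (Real.sin (s - η) : ℂ))
          (nhdsWithin 0 (Set.Ioi 0)) (nhds (G s))) ∧
      ∀ l : ℤ,
        (1 / (π : ℂ)) * ∫ s in (0:ℝ)..π,
            (Real.sin s : ℂ) * G s * Complex.exp (-2 * Complex.I * (l : ℂ) * (s : ℂ))
          = if l = 0 then -2 / ((k : ℂ) ^ 2 - 4)
            else -4 * (Int.sign l : ℂ)
              / (((k : ℂ) - 2 * (l : ℂ)) * (((k : ℂ) - 2 * (l : ℂ)) ^ 2 - 4)) := by
  obtain ⟨G, -, hG, hl⟩ := exists_isPrincipalValue_sinFourierCoeff hk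
  exact ⟨G, hG, hl⟩
end

section
/- Let α ∈ (0,1) ∪ (1,2) and let l be an integer. Then ∫_0^π sin(s)^{1−α}·e^{−2ils} ds = −2^{α−1}·cos(πα/2)·Γ(2−α)·Γ((α−1)/2 + |l|)/Γ((3−α)/2 + |l|), where the integral converges absolutely (the exponent 1−α is greater than −1). -/
open MeasureTheory Filter Set Real intervalIntegral

lemma image_one_sub_cos_div_two_Ioo :
    (fun s : ℝ => (1 - Real.cos s) / 2) '' Ioo 0 π = Ioo 0 1 := by
  ext x
  constructor
  · rintro ⟨s, ⟨h0, h1⟩, rfl⟩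
    have h2 : Real.cos s < Real.cos 0 :=
      Real.strictAntiOn_cos ⟨le_rfl, pi_pos.le⟩ ⟨h0.le, h1.le⟩ h0
    have h3 : Real.cos π < Real.cos s :=
      Real.strictAntiOn_cos ⟨h0.le, h1.le⟩ ⟨pi_pos.le, le_rfl⟩ h1
    rw [Real.cos_zero] at h2
    rw [Real.cos_pi] at h3
    exact ⟨by linarith, by linarith⟩
  · rintro ⟨h0, h1⟩
    refine ⟨Real.arccos (1 - 2 * x), ⟨?_, ?_⟩, ?_⟩
    · exact Real.arccos_pos.2 (by linarith)
    · refine lt_of_le_of_ne (Real.arccos_le_pi _) fun h => ?_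
      have := Real.arccos_eq_pi.1 h
      linarith
    · beta_reduce
      rw [Real.cos_arccos (by linarith) (by linarith)]
      ring

lemma injOn_one_sub_cos_div_two : InjOn (fun s : ℝ => (1 - Real.cos s) / 2) (Ioo 0 π) := by
  intro x hx y hy h
  refine Real.injOn_cos (Ioo_subset_Icc_self hx) (Ioo_subset_Icc_self hy) ?_
  have : (1 - Real.cos x) / 2 = (1 - Real.cos y) / 2 := h
  linarith

lemma hasDerivAt_one_sub_cos_div_two (s : ℝ) :
    HasDerivAt (fun s : ℝ => (1 - Real.cos s) / 2) (Real.sin s / 2) s := by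
  simpa using ((Real.hasDerivAt_cos s).const_sub 1).div_const 2

/-- The beta integrand with equal parameters, pulled back along `s ↦ (1 - cos s) / 2`. -/
lemma beta_integrand_one_sub_cos_div_two (a : ℝ) {s : ℝ} (hs : s ∈ Ioo 0 π) :
    |Real.sin s / 2| • ((((1 - Real.cos s) / 2 : ℝ) : ℂ) ^ ((((a + 1) / 2 : ℝ) : ℂ) - 1) *
      (1 - (((1 - Real.cos s) / 2 : ℝ) : ℂ)) ^ ((((a + 1) / 2 : ℝ) : ℂ) - 1)) =
    (((2 : ℝ) ^ (-a) * Real.sin s ^ a : ℝ) : ℂ) := by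
  have hx : (1 - Real.cos s) / 2 ∈ Ioo (0 : ℝ) 1 :=
    image_one_sub_cos_div_two_Ioo ▸ mem_image_of_mem _ hs
  have hsin : 0 < Real.sin s := Real.sin_pos_of_mem_Ioo hs
  rw [← Complex.ofReal_one, ← Complex.ofReal_sub, ← Complex.ofReal_sub,
    ← Complex.ofReal_cpow hx.1.le, ← Complex.ofReal_cpow (by linarith [hx.2]),
    ← Complex.ofReal_mul, Complex.real_smul, ← Complex.ofReal_mul]
  congr 1
  rw [← Real.mul_rpow hx.1.le (by linarith [hx.2]), abs_of_pos (by positivity)]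
  have h : (1 - Real.cos s) / 2 * (1 - (1 - Real.cos s) / 2) = (Real.sin s / 2) ^ (2 : ℝ) := by
    rw [Real.rpow_two]
    nlinarith [Real.sin_sq_add_cos_sq s]
  rw [h, ← Real.rpow_mul (by positivity)]
  nth_rewrite 1 [← Real.rpow_one (Real.sin s / 2)]
  rw [← Real.rpow_add (by positivity), show 1 + 2 * ((a + 1) / 2 - 1) = a by ring,
    Real.div_rpow hsin.le zero_le_two, Real.rpow_neg zero_le_two]
  ring

lemma intervalIntegrable_sin_rpow {a : ℝ} (ha : -1 < a) :
    IntervalIntegrable (fun s : ℝ => ((Real.sin s ^ a : ℝ) : ℂ)) volume 0 π := by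
  have hu : 0 < ((((a + 1) / 2 : ℝ) : ℂ)).re := by
    rw [Complex.ofReal_re]; linarith
  have hb := Complex.betaIntegral_convergent hu hu
  rw [intervalIntegrable_iff_integrableOn_Ioo_of_le zero_le_one,
    ← image_one_sub_cos_div_two_Ioo,
    integrableOn_image_iff_integrableOn_abs_deriv_smul measurableSet_Ioo
      (fun x _ => (hasDerivAt_one_sub_cos_div_two x).hasDerivWithinAt)
      injOn_one_sub_cos_div_two,
    integrableOn_congr_fun (fun s hs => beta_integrand_one_sub_cos_div_two a hs)
      measurableSet_Ioo] at hb
  rw [intervalIntegrable_iff_integrableOn_Ioo_of_le pi_pos.le]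
  refine IntegrableOn.congr_fun (hb.const_mul (((2 : ℝ) ^ a : ℝ) : ℂ)) (fun s _ => ?_)
    measurableSet_Ioo
  rw [← Complex.ofReal_mul, ← mul_assoc, ← Real.rpow_add two_pos]
  simp

lemma integral_sin_rpow {a : ℝ} (ha : -1 < a) :
    ∫ s in (0 : ℝ)..π, ((Real.sin s ^ a : ℝ) : ℂ) =
      ((2 ^ a * Real.Gamma ((a + 1) / 2) ^ 2 / Real.Gamma (a + 1) : ℝ) : ℂ) := by
  have hu : 0 < ((((a + 1) / 2 : ℝ) : ℂ)).re := by
    rw [Complex.ofReal_re]; linarith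
  have hb := Complex.betaIntegral_eq_Gamma_mul_div _ _ hu hu
  rw [Complex.betaIntegral, integral_of_le zero_le_one, integral_Ioc_eq_integral_Ioo,
    ← image_one_sub_cos_div_two_Ioo,
    integral_image_eq_integral_abs_deriv_smul measurableSet_Ioo
      (fun x _ => (hasDerivAt_one_sub_cos_div_two x).hasDerivWithinAt)
      injOn_one_sub_cos_div_two,
    setIntegral_congr_fun measurableSet_Ioo
      (fun s hs => beta_integrand_one_sub_cos_div_two a hs)] at hb
  rw [integral_of_le pi_pos.le, integral_Ioc_eq_integral_Ioo]
  simp only [Complex.ofReal_mul] at hb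
  rw [MeasureTheory.integral_const_mul, ← Complex.ofReal_add, Complex.Gamma_ofReal,
    Complex.Gamma_ofReal, show (a + 1) / 2 + (a + 1) / 2 = a + 1 by ring] at hb
  have h2 : (((2 : ℝ) ^ a : ℝ) : ℂ) * (((2 : ℝ) ^ (-a) : ℝ) : ℂ) = 1 := by
    rw [← Complex.ofReal_mul, ← Real.rpow_add two_pos]
    simp
  rw [← one_mul (∫ s in Ioo 0 π, _), ← h2, mul_assoc, hb]
  push_cast
  ring

lemma intervalIntegrable_sin_rpow_mul_exp {a : ℝ} (ha : -1 < a) (c : ℂ) :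
    IntervalIntegrable (fun s : ℝ => ((Real.sin s ^ a : ℝ) : ℂ) * Complex.exp (c * (s : ℂ)))
      volume 0 π :=
  (intervalIntegrable_sin_rpow ha).mul_continuousOn (by fun_prop)

lemma integral_sin_rpow_mul_exp_recurrence {a : ℝ} (ha : -1 < a) (l : ℂ) :
    (a + 2 + 2 * l) * ∫ s in (0 : ℝ)..π,
        ((Real.sin s ^ a : ℝ) : ℂ) * Complex.exp (-2 * Complex.I * (l + 1) * (s : ℂ)) =
      (2 * l - a) * ∫ s in (0 : ℝ)..π,
        ((Real.sin s ^ a : ℝ) : ℂ) * Complex.exp (-2 * Complex.I * l * (s : ℂ)) := by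
  have hi1 := (intervalIntegrable_sin_rpow_mul_exp ha (-2 * Complex.I * (l + 1))).const_mul
    ((a + 2 + 2 * l) / 2)
  have hi0 := (intervalIntegrable_sin_rpow_mul_exp ha (-2 * Complex.I * l)).const_mul
    ((2 * l - a) / 2)
  have key := integral_eq_sub_of_hasDerivAt_of_le pi_pos.le
    (f := fun s : ℝ => ((Real.sin s ^ (a + 1) : ℝ) : ℂ) *
      Complex.exp (-Complex.I * (2 * l + 1) * (s : ℂ))) ?_ ?_ (hi1.sub hi0)
  · rw [intervalIntegral.integral_sub hi1 hi0, intervalIntegral.integral_const_mul,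
      intervalIntegral.integral_const_mul] at key
    simp only [Real.sin_pi, Real.sin_zero, Real.zero_rpow (by linarith : a + 1 ≠ 0),
      Complex.ofReal_zero, zero_mul, sub_zero] at key
    linear_combination 2 * key
  · refine ContinuousOn.mul (Continuous.continuousOn ?_) (by fun_prop)
    exact Complex.continuous_ofReal.comp
      (Real.continuous_sin.rpow_const fun _ => Or.inr (by linarith))
  · intro s hs
    have hsin : 0 < Real.sin s := Real.sin_pos_of_mem_Ioo hs
    have h1 := ((Real.hasDerivAt_sin s).rpow_const (p := a + 1) (Or.inl hsin.ne')).ofReal_comp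
    have h2 : HasDerivAt (fun s : ℝ => Complex.exp (-Complex.I * (2 * l + 1) * (s : ℂ)))
        (Complex.exp (-Complex.I * (2 * l + 1) * (s : ℂ)) * (-Complex.I * (2 * l + 1))) s := by
      simpa using ((Complex.ofRealCLM.hasDerivAt (x := s)).const_mul
        (-Complex.I * (2 * l + 1))).cexp
    refine (h1.mul h2).congr_deriv ?_
    have e1 : Complex.exp (-2 * Complex.I * (l + 1) * (s : ℂ)) =
        Complex.exp (-Complex.I * (2 * l + 1) * (s : ℂ)) *
          (Complex.cos s - Complex.sin s * Complex.I) := by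
      rw [← Complex.cos_neg, sub_eq_add_neg, ← neg_mul, ← Complex.sin_neg, ← Complex.exp_mul_I,
        ← Complex.exp_add]
      ring_nf
    have e0 : Complex.exp (-2 * Complex.I * l * (s : ℂ)) =
        Complex.exp (-Complex.I * (2 * l + 1) * (s : ℂ)) *
          (Complex.cos s + Complex.sin s * Complex.I) := by
      rw [← Complex.exp_mul_I, ← Complex.exp_add]
      ring_nf
    rw [e1, e0, Real.rpow_add_one hsin.ne', add_sub_cancel_right]
    push_cast
    ring

lemma integral_sin_rpow_eq_cos_mul_Gamma {α : ℝ} (hα1 : α ≠ 1) (hα0 : 0 < α) (hα2 : α < 2) :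
    2 ^ (1 - α) * Real.Gamma ((1 - α + 1) / 2) ^ 2 / Real.Gamma (1 - α + 1) =
      -(2 : ℝ) ^ (α - 1) * Real.cos (π * α / 2) * Real.Gamma (2 - α) *
        Real.Gamma ((α - 1) / 2) / Real.Gamma ((3 - α) / 2) := by
  have hdup := Real.Gamma_mul_Gamma_add_half ((2 - α) / 2)
  have hrefl := Real.Gamma_mul_Gamma_one_sub ((α - 1) / 2)
  rw [show (2 - α) / 2 + 1 / 2 = (3 - α) / 2 by ring, show 2 * ((2 - α) / 2) = 2 - α by ring,
    show 1 - (2 - α) = α - 1 by ring] at hdup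
  rw [show 1 - (α - 1) / 2 = (3 - α) / 2 by ring,
    show π * ((α - 1) / 2) = π * α / 2 - π / 2 by ring, Real.sin_sub_pi_div_two] at hrefl
  have hc : Real.cos (π * α / 2) ≠ 0 := by
    rw [← neg_ne_zero, ← Real.sin_sub_pi_div_two, Ne,
      Real.sin_eq_zero_iff_of_lt_of_lt (by nlinarith [pi_pos]) (by nlinarith [pi_pos])]
    intro h
    apply hα1
    have : π * (α - 1) = 0 := by linarith
    rcases mul_eq_zero.1 this with h | h
    · exact absurd h pi_ne_zero
    · linarith
  have hH : Real.Gamma ((3 - α) / 2) ≠ 0 := (Real.Gamma_pos_of_pos (by linarith)).ne'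
  have hK : Real.Gamma (2 - α) ≠ 0 := (Real.Gamma_pos_of_pos (by linarith)).ne'
  have hp : (2 : ℝ) ^ (α - 1) ≠ 0 := (Real.rpow_pos_of_pos two_pos _).ne'
  have hsq : √π ^ 2 = π := Real.sq_sqrt pi_pos.le
  rw [show 1 - α + 1 = 2 - α by ring, show 1 - α = -(α - 1) by ring,
    Real.rpow_neg zero_le_two]
  generalize Real.Gamma ((3 - α) / 2) = H at *
  generalize Real.Gamma ((2 - α) / 2) = G at *
  generalize Real.Gamma (2 - α) = K at *
  generalize Real.Gamma ((α - 1) / 2) = R at *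
  generalize (2 : ℝ) ^ (α - 1) = p at *
  generalize Real.cos (π * α / 2) = c at *
  rw [div_neg, eq_neg_iff_add_eq_zero] at hrefl
  have hR : R * H * c = -π := by
    field_simp at hrefl
    linarith
  have hG : (G * H) ^ 2 = K ^ 2 * p ^ 2 * π := by
    rw [hdup, ← hsq, hsq]
    linear_combination K ^ 2 * p ^ 2 * hsq
  field_simp
  apply mul_right_cancel₀ hH
  linear_combination hG + K ^ 2 * p ^ 2 * hR

lemma Gamma_add_one_div_Gamma_add_one {x y : ℝ} (hx : x ≠ 0) (hy : y ≠ 0) :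
    Real.Gamma (x + 1) / Real.Gamma (y + 1) = x / y * (Real.Gamma x / Real.Gamma y) := by
  rw [Real.Gamma_add_one hx, Real.Gamma_add_one hy, mul_div_mul_comm]

/-- A sequence satisfying the recurrence of `integral_sin_rpow_mul_exp_recurrence` is a
multiple of a quotient of Gamma values. -/
lemma eq_Gamma_div_Gamma_of_recurrence {α : ℝ} (hα1 : α ≠ 1) (hα0 : 0 < α) (hα2 : α < 2)
    {C : ℝ} {f : ℕ → ℂ}
    (h0 : f 0 = ((C * Real.Gamma ((α - 1) / 2) / Real.Gamma ((3 - α) / 2) : ℝ) : ℂ))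
    (hf : ∀ n : ℕ, (((1 - α : ℝ) : ℂ) + 2 + 2 * n) * f (n + 1) =
      (2 * n - ((1 - α : ℝ) : ℂ)) * f n) (n : ℕ) :
    f n = ((C * Real.Gamma ((α - 1) / 2 + n) / Real.Gamma ((3 - α) / 2 + n) : ℝ) : ℂ) := by
  induction n with
  | zero => simpa using h0
  | succ n ih =>
    have hn : (0 : ℝ) ≤ n := n.cast_nonneg
    have hx : (α - 1) / 2 + n ≠ 0 := by
      rcases Nat.eq_zero_or_pos n with rfl | h
      · simpa [sub_eq_zero] using hα1
      · have : (1 : ℝ) ≤ n := by exact_mod_cast h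
        linarith
    have hy : (3 - α) / 2 + n ≠ 0 := by linarith
    have hy' : (((1 - α : ℝ) : ℂ) + 2 + 2 * n) = ((2 * ((3 - α) / 2 + n) : ℝ) : ℂ) := by
      push_cast; ring
    have hx' : (2 * n - ((1 - α : ℝ) : ℂ)) = ((2 * ((α - 1) / 2 + n) : ℝ) : ℂ) := by
      push_cast; ring
    have h := hf n
    rw [ih, hy', hx', ← Complex.ofReal_mul] at h
    have hne : ((2 * ((3 - α) / 2 + n) : ℝ) : ℂ) ≠ 0 :=
      Complex.ofReal_ne_zero.2 (mul_ne_zero two_ne_zero hy)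
    apply mul_left_cancel₀ hne
    rw [h, ← Complex.ofReal_mul]
    congr 1
    push_cast
    rw [← add_assoc, ← add_assoc, mul_div_assoc C, mul_div_assoc C,
      Gamma_add_one_div_Gamma_add_one hx hy]
    generalize Real.Gamma ((α - 1) / 2 + n) / Real.Gamma ((3 - α) / 2 + n) = q
    generalize (3 - α) / 2 + (n : ℝ) = y at *
    field_simp

open MeasureTheory Filter Set Real intervalIntegral

/-- Evaluation of the integral I₁ (equations (28)–(32) of the paper). -/
theorem stmt_9 (α : ℝ) (hα : α ∈ Set.Ioo (0:ℝ) 1 ∪ Set.Ioo (1:ℝ) 2) (l : ℤ) :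
    IntervalIntegrable (fun s : ℝ =>
        ((Real.sin s ^ (1 - α) : ℝ) : ℂ) * Complex.exp (-2 * Complex.I * (l : ℂ) * (s : ℂ)))
      MeasureTheory.volume 0 π ∧
    ∫ s in (0:ℝ)..π,
        ((Real.sin s ^ (1 - α) : ℝ) : ℂ) * Complex.exp (-2 * Complex.I * (l : ℂ) * (s : ℂ))
      = ((-(2:ℝ) ^ (α - 1) * Real.cos (π * α / 2) * Real.Gamma (2 - α)
            * Real.Gamma ((α - 1) / 2 + |(l : ℝ)|) / Real.Gamma ((3 - α) / 2 + |(l : ℝ)|) : ℝ) : ℂ) := by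
  obtain ⟨hα1, hα0, hα2⟩ : α ≠ 1 ∧ 0 < α ∧ α < 2 := by
    rcases hα with h | h
    · exact ⟨h.2.ne, h.1, h.2.trans one_lt_two⟩
    · exact ⟨h.1.ne', one_pos.trans h.1, h.2⟩
  have ha : -1 < 1 - α := by linarith
  refine ⟨intervalIntegrable_sin_rpow_mul_exp ha _, ?_⟩
  set J : ℂ → ℂ := fun z => ∫ s in (0 : ℝ)..π,
    ((Real.sin s ^ (1 - α) : ℝ) : ℂ) * Complex.exp (-2 * Complex.I * z * (s : ℂ)) with hJ
  have hrec (z : ℂ) : (((1 - α : ℝ) : ℂ) + 2 + 2 * z) * J (z + 1) =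
      (2 * z - ((1 - α : ℝ) : ℂ)) * J z := integral_sin_rpow_mul_exp_recurrence ha z
  have h0 : J 0 = ((-(2 : ℝ) ^ (α - 1) * Real.cos (π * α / 2) * Real.Gamma (2 - α) *
      Real.Gamma ((α - 1) / 2) / Real.Gamma ((3 - α) / 2) : ℝ) : ℂ) := by
    rw [← integral_sin_rpow_eq_cos_mul_Gamma hα1 hα0 hα2, ← integral_sin_rpow ha]
    simp [hJ]
  change J l = _
  obtain ⟨n, rfl | rfl⟩ := l.eq_nat_or_neg
  · have := eq_Gamma_div_Gamma_of_recurrence hα1 hα0 hα2 (f := fun n : ℕ => J n)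
      (by rw [← h0, Nat.cast_zero]) (fun n => by simpa using hrec n) n
    simpa using this
  · have := eq_Gamma_div_Gamma_of_recurrence hα1 hα0 hα2 (f := fun n : ℕ => J (-n))
      (by rw [← h0, Nat.cast_zero, neg_zero]) (fun n => ?_) n
    · simpa using this
    · have h := hrec (-(n + 1 : ℕ))
      rw [show -((n + 1 : ℕ) : ℂ) + 1 = -n by push_cast; ring] at h
      push_cast at h ⊢
      linear_combination h
end
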